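/- arXiv:1706.06766 — 2 statements merged into one kernel-verified Lean document; each statement's English description precedes it below -/
import Mathlib

section
/- Let λ ∈ ℝ and let u be a solution of the mean field equation Δu = λ(1−e^u) on S². Then for each coordinate function x_i (i = 1, 2, 3), (λ−2) ∫_{S²} x_i e^{u(x)} dσ(x) = 0. In particular, if λ ≠ 2, then ∫_{S²} x_i e^{u(x)} dσ(x) = 0 for i = 1, 2, 3. -/
open Real MeasureTheory

noncomputable section

/-- Euclidean Laplacian on ℝ² via the second iterated derivative. -/
def lap (w : ℝ × ℝ → ℝ) (y : ℝ × ℝ) : ℝ :=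
  iteratedFDeriv ℝ 2 w y ![(1, 0), (1, 0)] + iteratedFDeriv ℝ 2 w y ![(0, 1), (0, 1)]

/-- The unit sphere S² ⊂ ℝ³ (vectors encoded as functions `Fin 3 → ℝ`). -/
def sphere3 : Set (Fin 3 → ℝ) := {x | x 0 ^ 2 + x 1 ^ 2 + x 2 ^ 2 = 1}

/-- Inverse stereographic projection from the north pole. -/
def stereoN (y : ℝ × ℝ) : Fin 3 → ℝ :=
  ![2 * y.1 / (1 + y.1 ^ 2 + y.2 ^ 2), 2 * y.2 / (1 + y.1 ^ 2 + y.2 ^ 2),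
    (y.1 ^ 2 + y.2 ^ 2 - 1) / (1 + y.1 ^ 2 + y.2 ^ 2)]

/-- South-pole parametrization of the sphere. -/
def stereoS (y : ℝ × ℝ) : Fin 3 → ℝ :=
  ![2 * y.1 / (1 + y.1 ^ 2 + y.2 ^ 2), 2 * y.2 / (1 + y.1 ^ 2 + y.2 ^ 2),
    (1 - y.1 ^ 2 - y.2 ^ 2) / (1 + y.1 ^ 2 + y.2 ^ 2)]

/-- `u` is a solution of the mean field equation `Δu = lam (1 - e^u)` on `S²`,
expressed in the two stereographic charts. -/
def IsMFSolution (lam : ℝ) (u : (Fin 3 → ℝ) → ℝ) : Prop :=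
  ContinuousOn u sphere3 ∧
  ContDiff ℝ 2 (fun y => u (stereoN y)) ∧
  ContDiff ℝ 2 (fun y => u (stereoS y)) ∧
  (∀ y : ℝ × ℝ, lap (fun z => u (stereoN z)) y =
    4 * lam * (1 - Real.exp (u (stereoN y))) / (1 + y.1 ^ 2 + y.2 ^ 2) ^ 2) ∧
  (∀ y : ℝ × ℝ, lap (fun z => u (stereoS z)) y =
    4 * lam * (1 - Real.exp (u (stereoS y))) / (1 + y.1 ^ 2 + y.2 ^ 2) ^ 2)

/-- `u` is axially symmetric on `S²`: constant on the level sets of `⟨·, e⟩`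
for some unit vector `e`. -/
def AxiallySymmetric (u : (Fin 3 → ℝ) → ℝ) : Prop :=
  ∃ e : Fin 3 → ℝ, e 0 ^ 2 + e 1 ^ 2 + e 2 ^ 2 = 1 ∧
    ∀ x ∈ sphere3, ∀ x' ∈ sphere3,
      x 0 * e 0 + x 1 * e 1 + x 2 * e 2 = x' 0 * e 0 + x' 1 * e 1 + x' 2 * e 2 →
      u x = u x'

/-- Surface integral over `S²`, written in the north-pole stereographic chart. -/
def sphereIntegral (f : (Fin 3 → ℝ) → ℝ) : ℝ :=
  ∫ y : ℝ × ℝ, f (stereoN y) * (4 / (1 + y.1 ^ 2 + y.2 ^ 2) ^ 2)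

open Filter Topology Set in
lemma kw_div_zero (G1 G2 : ℝ × ℝ → ℝ) (h1 : Differentiable ℝ G1) (h2 : Differentiable ℝ G2)
    (C : ℝ) (b1 : ∀ y, |G1 y| ≤ C / (1 + y.1 ^ 2 + y.2 ^ 2))
    (b2 : ∀ y, |G2 y| ≤ C / (1 + y.1 ^ 2 + y.2 ^ 2))
    (hIntegr : Integrable (fun y => fderiv ℝ G1 y (1, 0) + fderiv ℝ G2 y (0, 1))) :
    ∫ y, (fderiv ℝ G1 y (1, 0) + fderiv ℝ G2 y (0, 1)) = 0 := by
  have hC : 0 ≤ C := by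
    have := (abs_nonneg _).trans (b1 0)
    simpa using this
  have hcov : AECover (volume : Measure (ℝ × ℝ)) atTop
      (fun R : ℝ => Metric.closedBall (0 : ℝ × ℝ) R) := aecover_closedBall tendsto_id
  have ht := hcov.integral_tendsto_of_countably_generated hIntegr
  refine tendsto_nhds_unique ht ?_
  have hle : ∀ᶠ R : ℝ in atTop, ‖∫ y in Metric.closedBall (0 : ℝ × ℝ) R,
      (fderiv ℝ G1 y (1, 0) + fderiv ℝ G2 y (0, 1))‖ ≤ (8 * C) * R⁻¹ := by
    filter_upwards [eventually_gt_atTop 0] with R hR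
    have hb : Metric.closedBall (0 : ℝ × ℝ) R = Icc (-R, -R) (R, R) := by
      rw [← Icc_prod_Icc, ← Prod.mk_zero_zero, ← closedBall_prod_same, Real.closedBall_eq_Icc]
      simp
    rw [hb, integral_divergence_prod_Icc_of_hasFDerivAt_of_le G1 G2 (fderiv ℝ G1) (fderiv ℝ G2)
      (-R, -R) (R, R) (by constructor <;> simp <;> linarith) h1.continuous.continuousOn
      h2.continuous.continuousOn (fun x _ => (h1 x).hasFDerivAt)
      (fun x _ => (h2 x).hasFDerivAt) hIntegr.integrableOn]
    have key : ∀ f : ℝ → ℝ, (∀ x, |f x| ≤ C / R ^ 2) →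
        |∫ x in (-R)..R, f x| ≤ 2 * C * R⁻¹ := by
      intro f hf
      have := intervalIntegral.norm_integral_le_of_norm_le_const (a := -R) (b := R) (f := f)
        (C := C / R ^ 2) (fun x _ => hf x)
      rw [Real.norm_eq_abs] at this
      refine this.trans (le_of_eq ?_)
      rw [abs_of_pos (by linarith)]
      field_simp
      ring
    have hg : ∀ x s : ℝ, s ^ 2 = R ^ 2 → C / (1 + x ^ 2 + s ^ 2) ≤ C / R ^ 2 := by
      intro x s hs
      rw [hs]
      gcongr
      nlinarith [sq_nonneg x]
    have hg' : ∀ x s : ℝ, s ^ 2 = R ^ 2 → C / (1 + s ^ 2 + x ^ 2) ≤ C / R ^ 2 := by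
      intro x s hs
      rw [hs]
      gcongr
      nlinarith [sq_nonneg x]
    have k1 := key (fun x => G2 (x, R)) (fun x => (b2 _).trans (hg _ _ rfl))
    have k2 := key (fun x => G2 (x, -R)) (fun x => (b2 _).trans (hg _ _ (by ring)))
    have k3 := key (fun x => G1 (R, x)) (fun x => (b1 _).trans (hg' _ _ rfl))
    have k4 := key (fun x => G1 (-R, x)) (fun x => (b1 _).trans (hg' _ _ (by ring)))
    rw [abs_le] at k1 k2 k3 k4
    rw [Real.norm_eq_abs, abs_le]
    dsimp only at *
    constructor <;> linarith [k1.1, k1.2, k2.1, k2.2, k3.1, k3.2, k4.1, k4.2]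
  refine squeeze_zero_norm' hle ?_
  simpa using tendsto_inv_atTop_zero.const_mul (8 * C)

lemma kw_integrable (f : ℝ × ℝ → ℝ) (hf : Continuous f) (C : ℝ)
    (hb : ∀ y, |f y| ≤ C / (1 + y.1 ^ 2 + y.2 ^ 2) ^ 2) : Integrable f := by
  have hC : 0 ≤ C := by
    have := (abs_nonneg _).trans (hb 0)
    simpa using this
  have hi : Integrable (fun y : ℝ × ℝ => (1 + y.1 ^ 2)⁻¹ * (1 + y.2 ^ 2)⁻¹) :=
    Integrable.mul_prod integrable_inv_one_add_sq integrable_inv_one_add_sq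
  refine (hi.const_mul C).mono' hf.aestronglyMeasurable (Filter.Eventually.of_forall fun y => ?_)
  rw [Real.norm_eq_abs]
  refine (hb y).trans ?_
  rw [← mul_inv, ← div_eq_mul_inv]
  gcongr
  nlinarith [sq_nonneg y.1, sq_nonneg y.2, mul_nonneg (sq_nonneg y.1) (sq_nonneg y.2)]

lemma kw_part1 {f : ℝ × ℝ → ℝ} (hf : Differentiable ℝ f) (y : ℝ × ℝ) {d : ℝ}
    (h : HasDerivAt (fun t => f (t, y.2)) d y.1) : fderiv ℝ f y (1, 0) = d := by
  have h1 : HasDerivAt (fun t : ℝ => (t, y.2)) ((1, 0) : ℝ × ℝ) y.1 :=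
    (hasDerivAt_id y.1).prodMk (hasDerivAt_const y.1 y.2)
  exact (((hf y).hasFDerivAt).comp_hasDerivAt y.1 h1).unique h

lemma kw_part2 {f : ℝ × ℝ → ℝ} (hf : Differentiable ℝ f) (y : ℝ × ℝ) {d : ℝ}
    (h : HasDerivAt (fun t => f (y.1, t)) d y.2) : fderiv ℝ f y (0, 1) = d := by
  have h1 : HasDerivAt (fun t : ℝ => (y.1, t)) ((0, 1) : ℝ × ℝ) y.2 :=
    (hasDerivAt_const y.2 y.1).prodMk (hasDerivAt_id y.2)
  exact (((hf y).hasFDerivAt).comp_hasDerivAt y.2 h1).unique h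

/-- Gradient decay and boundedness from the second chart. -/
lemma kw_bounds (w v : ℝ × ℝ → ℝ) (hw : ContDiff ℝ 1 w) (hv : ContDiff ℝ 1 v)
    (hwv : ∀ y : ℝ × ℝ, y ≠ 0 →
      w y = v (y.1 / (y.1 ^ 2 + y.2 ^ 2), y.2 / (y.1 ^ 2 + y.2 ^ 2))) :
    ∃ C : ℝ, 0 ≤ C ∧ (∀ y, |w y| ≤ C) ∧
      (∀ y, |fderiv ℝ w y (1, 0)| ≤ C / (1 + y.1 ^ 2 + y.2 ^ 2)) ∧
      (∀ y, |fderiv ℝ w y (0, 1)| ≤ C / (1 + y.1 ^ 2 + y.2 ^ 2)) := by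
  have hK : IsCompact (Metric.closedBall (0 : ℝ × ℝ) 1) := isCompact_closedBall _ _
  obtain ⟨C1, h1⟩ := hK.exists_bound_of_continuousOn hw.continuous.continuousOn
  obtain ⟨C2, h2⟩ := hK.exists_bound_of_continuousOn hv.continuous.continuousOn
  obtain ⟨C3, h3⟩ := hK.exists_bound_of_continuousOn
    (hw.continuous_fderiv one_ne_zero).continuousOn
  obtain ⟨C4, h4⟩ := hK.exists_bound_of_continuousOn
    (hv.continuous_fderiv one_ne_zero).continuousOn
  have z0 : (0 : ℝ × ℝ) ∈ Metric.closedBall (0 : ℝ × ℝ) 1 := by simp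
  have n1 := (norm_nonneg _).trans (h1 0 z0)
  have n2 := (norm_nonneg _).trans (h2 0 z0)
  have n3 := (norm_nonneg _).trans (h3 0 z0)
  have n4 := (norm_nonneg _).trans (h4 0 z0)
  have hin : ∀ y : ℝ × ℝ, y.1 ^ 2 + y.2 ^ 2 ≤ 1 → y ∈ Metric.closedBall (0 : ℝ × ℝ) 1 := by
    intro y hy
    rw [mem_closedBall_zero_iff, Prod.norm_def, sup_le_iff, Real.norm_eq_abs, Real.norm_eq_abs]
    constructor <;> rw [abs_le_one_iff_mul_self_le_one] <;>
      nlinarith [sq_nonneg y.1, sq_nonneg y.2]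
  have hinv : ∀ y : ℝ × ℝ, 1 < y.1 ^ 2 + y.2 ^ 2 →
      (y.1 / (y.1 ^ 2 + y.2 ^ 2), y.2 / (y.1 ^ 2 + y.2 ^ 2)) ∈
        Metric.closedBall (0 : ℝ × ℝ) 1 := by
    intro y hy
    apply hin
    have : (y.1 / (y.1 ^ 2 + y.2 ^ 2)) ^ 2 + (y.2 / (y.1 ^ 2 + y.2 ^ 2)) ^ 2
        = 1 / (y.1 ^ 2 + y.2 ^ 2) := by
      field_simp
    simp only [this]
    rw [div_le_one (by linarith)]
    exact hy.le
  have hne : ∀ y : ℝ × ℝ, 1 < y.1 ^ 2 + y.2 ^ 2 → y ≠ 0 := by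
    rintro y hy rfl
    norm_num at hy
  have hop : ∀ (T : ℝ × ℝ →L[ℝ] ℝ) (e : ℝ × ℝ) (c d : ℝ), ‖T‖ ≤ c → ‖e‖ ≤ d → 0 ≤ c →
      |T e| ≤ c * d := by
    intro T e c d hT he hc
    rw [← Real.norm_eq_abs]
    exact (T.le_opNorm e).trans (mul_le_mul hT he (norm_nonneg _) hc)
  have hsmall : ∀ (y e : ℝ × ℝ), ‖e‖ ≤ 1 → y.1 ^ 2 + y.2 ^ 2 ≤ 1 →
      |fderiv ℝ w y e| ≤ (C1 + C2 + 2 * C3 + 2 * C4) / (1 + y.1 ^ 2 + y.2 ^ 2) := by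
    intro y e he hy
    have := hop _ e _ 1 (h3 y (hin y hy)) he n3
    rw [le_div_iff₀ (by positivity)]
    have p : 0 ≤ |fderiv ℝ w y e| := abs_nonneg _
    nlinarith
  have hbig : ∀ (y e : ℝ × ℝ), 1 < y.1 ^ 2 + y.2 ^ 2 → ‖e‖ ≤ 1 / (y.1 ^ 2 + y.2 ^ 2) →
      |fderiv ℝ v (y.1 / (y.1 ^ 2 + y.2 ^ 2), y.2 / (y.1 ^ 2 + y.2 ^ 2)) e|
        ≤ (C1 + C2 + 2 * C3 + 2 * C4) / (1 + y.1 ^ 2 + y.2 ^ 2) := by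
    intro y e hy he
    have := hop _ e _ _ (h4 _ (hinv y hy)) he n4
    refine this.trans ?_
    rw [mul_one_div, div_le_div_iff₀ (by linarith) (by positivity)]
    nlinarith
  have hev : ∀ y : ℝ × ℝ, y ≠ 0 → ∀ᶠ z in nhds y,
      w z = v (z.1 / (z.1 ^ 2 + z.2 ^ 2), z.2 / (z.1 ^ 2 + z.2 ^ 2)) := by
    intro y hy
    filter_upwards [isOpen_ne.mem_nhds hy] with z hz using hwv z hz
  have hvd : Differentiable ℝ v := hv.differentiable one_ne_zero
  have hwd : Differentiable ℝ w := hw.differentiable one_ne_zero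
  refine ⟨C1 + C2 + 2 * C3 + 2 * C4, by positivity, ?_, ?_, ?_⟩
  · intro y
    rcases le_or_gt (y.1 ^ 2 + y.2 ^ 2) 1 with hy | hy
    · have := h1 y (hin y hy)
      rw [Real.norm_eq_abs] at this
      linarith
    · rw [hwv y (hne y hy)]
      have := h2 _ (hinv y hy)
      rw [Real.norm_eq_abs] at this
      linarith
  · intro y
    rcases le_or_gt (y.1 ^ 2 + y.2 ^ 2) 1 with hy | hy
    · exact hsmall y _ (by simp [Prod.norm_def]) hy
    · have hr : y.1 ^ 2 + y.2 ^ 2 ≠ 0 := by linarith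
      have d0 : HasDerivAt (fun t : ℝ => t ^ 2 + y.2 ^ 2) (2 * y.1) y.1 := by
        simpa using (hasDerivAt_pow 2 y.1).add_const (y.2 ^ 2)
      have d1 := ((hasDerivAt_id y.1).div d0 hr).prodMk
        ((hasDerivAt_const y.1 y.2).div d0 hr)
      have d2 := (hvd _).hasFDerivAt.comp_hasDerivAt y.1 d1
      have hcont : ContinuousAt (fun t : ℝ => (t, y.2)) y.1 := by fun_prop
      have d3 := d2.congr_of_eventuallyEq (hcont.eventually (hev y (hne y hy)))
      rw [kw_part1 hwd y d3]
      refine hbig y _ hy ?_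
      rw [Prod.norm_def, sup_le_iff, Real.norm_eq_abs, Real.norm_eq_abs]
      have hs : 0 < (y.1 ^ 2 + y.2 ^ 2) := by linarith
      have e : 1 / (y.1 ^ 2 + y.2 ^ 2) = (y.1 ^ 2 + y.2 ^ 2) / (y.1 ^ 2 + y.2 ^ 2) ^ 2 := by
        field_simp
      rw [e]
      constructor <;> rw [abs_div, abs_of_pos (pow_pos hs 2)] <;> gcongr <;> rw [abs_le] <;>
        (try simp only [id]) <;> constructor <;>
        nlinarith [sq_nonneg (y.1 + y.2), sq_nonneg (y.1 - y.2), sq_nonneg y.1, sq_nonneg y.2]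
  · intro y
    rcases le_or_gt (y.1 ^ 2 + y.2 ^ 2) 1 with hy | hy
    · exact hsmall y _ (by simp [Prod.norm_def]) hy
    · have hr : y.1 ^ 2 + y.2 ^ 2 ≠ 0 := by linarith
      have d0 : HasDerivAt (fun t : ℝ => y.1 ^ 2 + t ^ 2) (2 * y.2) y.2 := by
        simpa using (hasDerivAt_pow 2 y.2).const_add (y.1 ^ 2)
      have d1 := ((hasDerivAt_const y.2 y.1).div d0 hr).prodMk
        ((hasDerivAt_id y.2).div d0 hr)
      have d2 := (hvd _).hasFDerivAt.comp_hasDerivAt y.2 d1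
      have hcont : ContinuousAt (fun t : ℝ => (y.1, t)) y.2 := by fun_prop
      have d3 := d2.congr_of_eventuallyEq (hcont.eventually (hev y (hne y hy)))
      rw [kw_part2 hwd y d3]
      refine hbig y _ hy ?_
      rw [Prod.norm_def, sup_le_iff, Real.norm_eq_abs, Real.norm_eq_abs]
      have hs : 0 < (y.1 ^ 2 + y.2 ^ 2) := by linarith
      have e : 1 / (y.1 ^ 2 + y.2 ^ 2) = (y.1 ^ 2 + y.2 ^ 2) / (y.1 ^ 2 + y.2 ^ 2) ^ 2 := by
        field_simp
      rw [e]
      constructor <;> rw [abs_div, abs_of_pos (pow_pos hs 2)] <;> gcongr <;> rw [abs_le] <;>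
        (try simp only [id]) <;> constructor <;>
        nlinarith [sq_nonneg (y.1 + y.2), sq_nonneg (y.1 - y.2), sq_nonneg y.1, sq_nonneg y.2]

lemma kw_key (lam : ℝ) (w : ℝ × ℝ → ℝ) (hw : ContDiff ℝ 2 w)
    (hlap : ∀ y : ℝ × ℝ, lap w y =
      4 * lam * (1 - Real.exp (w y)) / (1 + y.1 ^ 2 + y.2 ^ 2) ^ 2)
    (C : ℝ) (hC : 0 ≤ C) (bw : ∀ y, |w y| ≤ C)
    (bp : ∀ y, |fderiv ℝ w y (1, 0)| ≤ C / (1 + y.1 ^ 2 + y.2 ^ 2))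
    (bq : ∀ y, |fderiv ℝ w y (0, 1)| ≤ C / (1 + y.1 ^ 2 + y.2 ^ 2))
    (φ A B X Y : ℝ × ℝ → ℝ) (dφ : Differentiable ℝ φ) (dA : Differentiable ℝ A)
    (dB : Differentiable ℝ B) (dX : Differentiable ℝ X) (dY : Differentiable ℝ Y)
    (φ1 : ∀ y, fderiv ℝ φ y (1, 0) = A y) (φ2 : ∀ y, fderiv ℝ φ y (0, 1) = B y)
    (hA : ∀ y, A y = 4 / (1 + y.1 ^ 2 + y.2 ^ 2) ^ 2 * X y)
    (hB : ∀ y, B y = 4 / (1 + y.1 ^ 2 + y.2 ^ 2) ^ 2 * Y y)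
    (hAB : ∀ y, fderiv ℝ A y (1, 0) + fderiv ℝ B y (0, 1) =
      -2 * (4 / (1 + y.1 ^ 2 + y.2 ^ 2) ^ 2) * φ y)
    (hXY : ∀ y, fderiv ℝ X y (1, 0) = fderiv ℝ Y y (0, 1))
    (hXY' : ∀ y, fderiv ℝ X y (0, 1) = - fderiv ℝ Y y (1, 0))
    (bφ : ∀ y, |φ y| ≤ 1) (bX : ∀ y, |X y| ≤ 1 + y.1 ^ 2 + y.2 ^ 2)
    (bY : ∀ y, |Y y| ≤ 1 + y.1 ^ 2 + y.2 ^ 2) :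
    (lam - 2) * ∫ y, φ y * Real.exp (w y) * (4 / (1 + y.1 ^ 2 + y.2 ^ 2) ^ 2) = 0 := by
  obtain ⟨P, hP⟩ : ∃ P : ℝ × ℝ → ℝ, ∀ y, P y = fderiv ℝ w y (1, 0) := ⟨_, fun _ => rfl⟩
  obtain ⟨Q, hQ⟩ : ∃ Q : ℝ × ℝ → ℝ, ∀ y, Q y = fderiv ℝ w y (0, 1) := ⟨_, fun _ => rfl⟩
  have dw : Differentiable ℝ w := hw.differentiable two_ne_zero
  have ddw : Differentiable ℝ (fderiv ℝ w) :=
    (hw.fderiv_right (m := 1) (by norm_num)).differentiable one_ne_zero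
  have ePQ : P = (fun y => fderiv ℝ w y (1, 0)) := funext hP
  have eQQ : Q = (fun y => fderiv ℝ w y (0, 1)) := funext hQ
  have dP : Differentiable ℝ P := by rw [ePQ]; fun_prop
  have dQ : Differentiable ℝ Q := by rw [eQQ]; fun_prop
  have fP : ∀ y e, fderiv ℝ P y e = fderiv ℝ (fderiv ℝ w) y e (1, 0) := by
    intro y e
    rw [ePQ, fderiv_clm_apply (ddw y) (by fun_prop)]
    simp
  have fQ : ∀ y e, fderiv ℝ Q y e = fderiv ℝ (fderiv ℝ w) y e (0, 1) := by
    intro y e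
    rw [eQQ, fderiv_clm_apply (ddw y) (by fun_prop)]
    simp
  have hsym : ∀ y, fderiv ℝ P y (0, 1) = fderiv ℝ Q y (1, 0) := by
    intro y
    rw [fP, fQ]
    exact (hw.contDiffAt.isSymmSndFDerivAt (by simp)).eq _ _
  have hL : ∀ y, fderiv ℝ P y (1, 0) + fderiv ℝ Q y (0, 1) =
      lam * (1 - Real.exp (w y)) * (4 / (1 + y.1 ^ 2 + y.2 ^ 2) ^ 2) := by
    intro y
    have := hlap y
    rw [lap, iteratedFDeriv_two_apply, iteratedFDeriv_two_apply] at this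
    simp only [Matrix.cons_val_zero, Matrix.cons_val_one] at this
    rw [fP, fQ, this]
    ring
  have bE : ∀ y, Real.exp (w y) ≤ Real.exp C := fun y =>
    Real.exp_le_exp.2 ((le_abs_self _).trans (bw y))
  have bP : ∀ y, |P y| ≤ C / (1 + y.1 ^ 2 + y.2 ^ 2) := fun y => by rw [hP]; exact bp y
  have bQ : ∀ y, |Q y| ≤ C / (1 + y.1 ^ 2 + y.2 ^ 2) := fun y => by rw [hQ]; exact bq y
  have bA : ∀ y, |A y| ≤ 4 / (1 + y.1 ^ 2 + y.2 ^ 2) := by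
    intro y
    have hr : 0 < 1 + y.1 ^ 2 + y.2 ^ 2 := by positivity
    rw [hA, abs_mul, abs_of_pos (by positivity)]
    calc _ ≤ 4 / (1 + y.1 ^ 2 + y.2 ^ 2) ^ 2 * (1 + y.1 ^ 2 + y.2 ^ 2) := by
          gcongr; exact bX y
      _ = _ := by field_simp
  have bB : ∀ y, |B y| ≤ 4 / (1 + y.1 ^ 2 + y.2 ^ 2) := by
    intro y
    have hr : 0 < 1 + y.1 ^ 2 + y.2 ^ 2 := by positivity
    rw [hB, abs_mul, abs_of_pos (by positivity)]
    calc _ ≤ 4 / (1 + y.1 ^ 2 + y.2 ^ 2) ^ 2 * (1 + y.1 ^ 2 + y.2 ^ 2) := by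
          gcongr; exact bY y
      _ = _ := by field_simp
  have cw := dw.continuous
  have cφ := dφ.continuous
  have hpos : ∀ y : ℝ × ℝ, (1 + y.1 ^ 2 + y.2 ^ 2) ≠ 0 := fun y => by positivity
  have hIntegr : Integrable (fun y : ℝ × ℝ =>
      φ y * Real.exp (w y) * (4 / (1 + y.1 ^ 2 + y.2 ^ 2) ^ 2)) := by
    refine kw_integrable _ ?_ (4 * Real.exp C) ?_
    · have : ∀ y : ℝ × ℝ, (1 + y.1 ^ 2 + y.2 ^ 2) ^ 2 ≠ 0 := fun y => pow_ne_zero _ (hpos y)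
      fun_prop (disch := assumption)
    · intro y
      have e : |φ y * Real.exp (w y)| ≤ 1 * Real.exp C := by
        rw [abs_mul, Real.abs_exp]
        exact mul_le_mul (bφ y) (bE y) (Real.exp_pos _).le zero_le_one
      rw [abs_mul, abs_of_pos (show 0 < 4 / (1 + y.1 ^ 2 + y.2 ^ 2) ^ 2 by positivity)]
      calc _ ≤ 1 * Real.exp C * (4 / (1 + y.1 ^ 2 + y.2 ^ 2) ^ 2) := by gcongr
        _ = _ := by ring
  by_cases hlam : lam = 0
  · -- `w` is harmonic, hence has vanishing gradient
    have hd : ∀ y, fderiv ℝ (fun z => w z * P z) y (1, 0) +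
        fderiv ℝ (fun z => w z * Q z) y (0, 1) = P y ^ 2 + Q y ^ 2 := by
      intro y
      rw [fderiv_fun_mul (dw y) (dP y), fderiv_fun_mul (dw y) (dQ y)]
      have := hL y
      simp [hlam] at this
      simp [← hP, ← hQ]
      linear_combination w y * this
    have hPQi : Integrable (fun y => P y ^ 2 + Q y ^ 2) := by
      have cP := dP.continuous
      have cQ := dQ.continuous
      refine kw_integrable _ (by fun_prop) (2 * C ^ 2) ?_
      intro y
      rw [abs_of_nonneg (by positivity), ← sq_abs (P y), ← sq_abs (Q y)]
      calc _ ≤ (C / (1 + y.1 ^ 2 + y.2 ^ 2)) ^ 2 + (C / (1 + y.1 ^ 2 + y.2 ^ 2)) ^ 2 := by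
            gcongr
            · exact bP y
            · exact bQ y
        _ = _ := by rw [div_pow]; ring
    have h0 := kw_div_zero (fun z => w z * P z) (fun z => w z * Q z) (dw.mul dP) (dw.mul dQ)
      (C * C) (fun y => by
        rw [abs_mul, mul_div_assoc]
        exact mul_le_mul (bw y) (bP y) (abs_nonneg _) hC) (fun y => by
        rw [abs_mul, mul_div_assoc]
        exact mul_le_mul (bw y) (bQ y) (abs_nonneg _) hC) (by simpa only [hd] using hPQi)
    simp only [hd] at h0
    have h00 : (fun y => P y ^ 2 + Q y ^ 2) = 0 := by
      have hnn : 0 ≤ (fun y => P y ^ 2 + Q y ^ 2) := by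
        intro y
        show 0 ≤ P y ^ 2 + Q y ^ 2
        positivity
      have hae := (integral_eq_zero_iff_of_nonneg hnn hPQi).1 h0
      exact (Continuous.ae_eq_iff_eq volume
        ((dP.continuous.pow 2).add (dQ.continuous.pow 2)) continuous_zero).1 hae
    have hP0 : ∀ y, P y = 0 := by
      intro y
      have := congrFun h00 y
      simp only [Pi.zero_apply] at this
      nlinarith [sq_nonneg (P y), sq_nonneg (Q y)]
    have hQ0 : ∀ y, Q y = 0 := by
      intro y
      have := congrFun h00 y
      simp only [Pi.zero_apply] at this
      nlinarith [sq_nonneg (P y), sq_nonneg (Q y)]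
    have hd2 : ∀ y, fderiv ℝ (fun z => Real.exp (w z) * A z) y (1, 0) +
        fderiv ℝ (fun z => Real.exp (w z) * B z) y (0, 1) =
        -2 * (φ y * Real.exp (w y) * (4 / (1 + y.1 ^ 2 + y.2 ^ 2) ^ 2)) := by
      intro y
      rw [fderiv_fun_mul (dw y).exp (dA y), fderiv_fun_mul (dw y).exp (dB y), fderiv_exp (dw y)]
      have := hAB y
      simp only [add_apply, smul_apply, smul_eq_mul,
        ← hP, ← hQ, hP0, hQ0]
      linear_combination Real.exp (w y) * this
    have h1 := kw_div_zero (fun z => Real.exp (w z) * A z) (fun z => Real.exp (w z) * B z)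
      (dw.exp.mul dA) (dw.exp.mul dB) (Real.exp C * 4) (fun y => by
        rw [abs_mul, mul_div_assoc, Real.abs_exp]
        exact mul_le_mul (bE y) (bA y) (abs_nonneg _) (Real.exp_pos _).le) (fun y => by
        rw [abs_mul, mul_div_assoc, Real.abs_exp]
        exact mul_le_mul (bE y) (bB y) (abs_nonneg _) (Real.exp_pos _).le)
      (by simpa only [hd2] using hIntegr.const_mul (-2))
    simp only [hd2] at h1
    rw [integral_const_mul] at h1
    have : (∫ y, φ y * Real.exp (w y) * (4 / (1 + y.1 ^ 2 + y.2 ^ 2) ^ 2)) = 0 := by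
      linarith
    rw [this, mul_zero]
  · obtain ⟨G, hG⟩ : ∃ G : ℝ × ℝ → ℝ, G = fun z => 1 / 2 * (P z * P z - Q z * Q z) * X z +
        P z * Q z * Y z + (lam * Real.exp (w z) - lam ^ 2 / 2) * A z - lam * (φ z * P z) :=
      ⟨_, rfl⟩
    obtain ⟨H, hH⟩ : ∃ H : ℝ × ℝ → ℝ, H = fun z => P z * Q z * X z -
        1 / 2 * (P z * P z - Q z * Q z) * Y z
        + (lam * Real.exp (w z) - lam ^ 2 / 2) * B z - lam * (φ z * Q z) :=
      ⟨_, rfl⟩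
    have dG : Differentiable ℝ G := by rw [hG]; fun_prop
    have dH : Differentiable ℝ H := by rw [hH]; fun_prop
    have hd : ∀ y, fderiv ℝ G y (1, 0) + fderiv ℝ H y (0, 1) =
        lam * (lam - 2) * (φ y * Real.exp (w y) * (4 / (1 + y.1 ^ 2 + y.2 ^ 2) ^ 2)) := by
      intro y
      have w' := (dw y).hasFDerivAt
      have P' := (dP y).hasFDerivAt
      have Q' := (dQ y).hasFDerivAt
      have X' := (dX y).hasFDerivAt
      have Y' := (dY y).hasFDerivAt
      have A' := (dA y).hasFDerivAt
      have B' := (dB y).hasFDerivAt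
      have f' := (dφ y).hasFDerivAt
      have s' := ((P'.mul P').sub (Q'.mul Q')).const_mul (1 / 2)
      have t' := P'.mul Q'
      have e' := (w'.exp.const_mul lam).sub_const (lam ^ 2 / 2)
      have G' := (((s'.mul X').add (t'.mul Y')).add (e'.mul A')).sub
        ((f'.mul P').const_mul lam)
      have H' := (((t'.mul X').sub (s'.mul Y')).add (e'.mul B')).sub
        ((f'.mul Q').const_mul lam)
      have gG := (G'.congr_of_eventuallyEq (Filter.EventuallyEq.of_eq (f := G) hG)).fderiv
      have gH := (H'.congr_of_eventuallyEq (Filter.EventuallyEq.of_eq (f := H) hH)).fderiv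
      rw [gG, gH]
      simp only [add_apply, sub_apply,
        smul_apply, smul_eq_mul, ← hP, ← hQ, φ1, φ2, hXY, hXY', hsym,
        Pi.mul_apply, Pi.sub_apply]
      have l1 := hL y
      have l2 := hAB y
      have l3 := hA y
      have l4 := hB y
      linear_combination (P y * X y + Q y * Y y - lam * φ y) * l1 +
        (lam * Real.exp (w y) - lam ^ 2 / 2) * l2 +
        (lam * Real.exp (w y) * P y - lam * P y) * l3 +
        (lam * Real.exp (w y) * Q y - lam * Q y) * l4
    have bs : ∀ a b c d e f x y' r : ℝ, 0 < r → |a| ≤ C / r → |b| ≤ C / r → |x| ≤ r → |y'| ≤ r →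
        |c| ≤ |lam| * Real.exp C + lam ^ 2 / 2 → |d| ≤ 4 / r → |e| ≤ 1 → |f| ≤ C / r →
        |1 / 2 * (a * a - b * b) * x| + |a * b * y'| + |c * d| + |lam * (e * f)| ≤
          (2 * C ^ 2 + (|lam| * Real.exp C + lam ^ 2 / 2) * 4 + |lam| * C) / r := by
      intro a b c d e f x y' r hr ha hb hx hy hc hd he hf
      have t0 : 0 ≤ C / r := by positivity
      have e1 : |1 / 2 * (a * a - b * b) * x| ≤ (C / r * (C / r)) * r := by
        rw [abs_mul]
        refine mul_le_mul ?_ hx (abs_nonneg _) (by positivity)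
        have h1 := mul_le_mul ha ha (abs_nonneg _) t0
        have h2 := mul_le_mul hb hb (abs_nonneg _) t0
        rw [abs_mul_abs_self] at h1 h2
        rw [abs_le]
        constructor <;> nlinarith [mul_self_nonneg a, mul_self_nonneg b]
      have e2 : |a * b * y'| ≤ (C / r * (C / r)) * r := by
        rw [abs_mul, abs_mul]
        gcongr
      have e3 : |c * d| ≤ (|lam| * Real.exp C + lam ^ 2 / 2) * (4 / r) := by
        rw [abs_mul]
        gcongr
      have e4 : |lam * (e * f)| ≤ |lam| * (1 * (C / r)) := by
        rw [abs_mul, abs_mul]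
        gcongr
      have : (2 * C ^ 2 + (|lam| * Real.exp C + lam ^ 2 / 2) * 4 + |lam| * C) / r =
        (C / r * (C / r)) * r + (C / r * (C / r)) * r +
          (|lam| * Real.exp C + lam ^ 2 / 2) * (4 / r) + |lam| * (1 * (C / r)) := by
        field_simp
        ring
      linarith
    have bc : ∀ y, |lam * Real.exp (w y) - lam ^ 2 / 2| ≤
        |lam| * Real.exp C + lam ^ 2 / 2 := by
      intro y
      refine (abs_sub _ _).trans ?_
      rw [abs_mul, Real.abs_exp, abs_of_nonneg (show 0 ≤ lam ^ 2 / 2 by positivity)]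
      gcongr
      exact (le_abs_self _).trans (bw y)
    have tri : ∀ a b c d : ℝ, |a + b + c - d| ≤ |a| + |b| + |c| + |d| := fun a b c d => by
      rw [abs_le]
      constructor <;> linarith [neg_abs_le a, le_abs_self a, neg_abs_le b, le_abs_self b,
        neg_abs_le c, le_abs_self c, neg_abs_le d, le_abs_self d]
    have tri' : ∀ a b c d : ℝ, |a - b + c - d| ≤ |b| + |a| + |c| + |d| := fun a b c d => by
      rw [abs_le]
      constructor <;> linarith [neg_abs_le a, le_abs_self a, neg_abs_le b, le_abs_self b,
        neg_abs_le c, le_abs_self c, neg_abs_le d, le_abs_self d]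
    have h0 := kw_div_zero G H dG dH
      (2 * C ^ 2 + (|lam| * Real.exp C + lam ^ 2 / 2) * 4 + |lam| * C)
      (fun y => by
        rw [hG]
        exact (tri _ _ _ _).trans (bs (P y) (Q y) _ _ _ _ _ _ _ (by positivity) (bP y) (bQ y)
          (bX y) (bY y) (bc y) (bA y) (bφ y) (bP y)))
      (fun y => by
        rw [hH]
        exact (tri' _ _ _ _).trans (bs (P y) (Q y) _ _ _ _ _ _ _ (by positivity) (bP y) (bQ y)
          (bY y) (bX y) (bc y) (bB y) (bφ y) (bQ y)))
      (by simpa only [hd] using hIntegr.const_mul (lam * (lam - 2)))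
    simp only [hd] at h0
    rw [integral_const_mul, mul_assoc] at h0
    exact (mul_eq_zero.1 h0).resolve_left hlam

lemma kw_ddiv {f g : ℝ × ℝ → ℝ} (hf : Differentiable ℝ f) (hg : Differentiable ℝ g)
    (h : ∀ z, g z ≠ 0) : Differentiable ℝ (fun z => f z / g z) := by
  simp only [div_eq_mul_inv]
  exact hf.mul (hg.inv h)

lemma kw_chart (y : ℝ × ℝ) (hy : y ≠ 0) :
    stereoN y = stereoS (y.1 / (y.1 ^ 2 + y.2 ^ 2), y.2 / (y.1 ^ 2 + y.2 ^ 2)) := by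
  have hr : y.1 ^ 2 + y.2 ^ 2 ≠ 0 := by
    intro h
    apply hy
    ext
    · simp; nlinarith [sq_nonneg y.1, sq_nonneg y.2]
    · simp; nlinarith [sq_nonneg y.1, sq_nonneg y.2]
  have hr1 : 1 + y.1 ^ 2 + y.2 ^ 2 ≠ 0 := by positivity
  have e : 1 + (y.1 / (y.1 ^ 2 + y.2 ^ 2)) ^ 2 + (y.2 / (y.1 ^ 2 + y.2 ^ 2)) ^ 2
      = (1 + y.1 ^ 2 + y.2 ^ 2) / (y.1 ^ 2 + y.2 ^ 2) := by
    field_simp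
    ring
  have e' : 1 - (y.1 / (y.1 ^ 2 + y.2 ^ 2)) ^ 2 - (y.2 / (y.1 ^ 2 + y.2 ^ 2)) ^ 2
      = (y.1 ^ 2 + y.2 ^ 2 - 1) / (y.1 ^ 2 + y.2 ^ 2) := by
    field_simp
    ring
  unfold stereoN stereoS
  simp only [e, e']
  congr 1
  · field_simp
  congr 1
  · field_simp
  congr 1
  · field_simp

lemma kw_r1 (y : ℝ × ℝ) : HasDerivAt (fun t : ℝ => 1 + t ^ 2 + y.2 ^ 2) (2 * y.1) y.1 := by
  simpa using ((hasDerivAt_pow 2 y.1).const_add 1).add_const (y.2 ^ 2)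

lemma kw_r2 (y : ℝ × ℝ) : HasDerivAt (fun t : ℝ => 1 + y.1 ^ 2 + t ^ 2) (2 * y.2) y.2 := by
  simpa using (hasDerivAt_pow 2 y.2).const_add (1 + y.1 ^ 2)

/-- Derivative of a quotient `N / r ^ k` in the first variable. -/
lemma kw_quot1 (N : ℝ × ℝ → ℝ) (k : ℕ) (hN : Differentiable ℝ N) (y : ℝ × ℝ) (n : ℝ)
    (h : HasDerivAt (fun t => N (t, y.2)) n y.1) :
    fderiv ℝ (fun z : ℝ × ℝ => N z / (1 + z.1 ^ 2 + z.2 ^ 2) ^ k) y (1, 0) =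
      (n * (1 + y.1 ^ 2 + y.2 ^ 2) - N y * (k * (2 * y.1))) /
        (1 + y.1 ^ 2 + y.2 ^ 2) ^ (k + 1) := by
  have hp : ∀ z : ℝ × ℝ, (1 + z.1 ^ 2 + z.2 ^ 2) ^ k ≠ 0 := fun z => by positivity
  have hd : Differentiable ℝ (fun z : ℝ × ℝ => N z / (1 + z.1 ^ 2 + z.2 ^ 2) ^ k) :=
    kw_ddiv hN (by fun_prop) hp
  refine kw_part1 hd y ((h.div ((kw_r1 y).pow k) (hp y)).congr_deriv ?_)
  have hr : (1 + y.1 ^ 2 + y.2 ^ 2) ≠ 0 := by positivity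
  rcases k with _ | k
  · simp; field_simp
  · simp
    rw [div_eq_div_iff (by positivity) (by positivity)]
    generalize 1 + y.1 ^ 2 + y.2 ^ 2 = r
    ring

lemma kw_quot2 (N : ℝ × ℝ → ℝ) (k : ℕ) (hN : Differentiable ℝ N) (y : ℝ × ℝ) (n : ℝ)
    (h : HasDerivAt (fun t => N (y.1, t)) n y.2) :
    fderiv ℝ (fun z : ℝ × ℝ => N z / (1 + z.1 ^ 2 + z.2 ^ 2) ^ k) y (0, 1) =
      (n * (1 + y.1 ^ 2 + y.2 ^ 2) - N y * (k * (2 * y.2))) /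
        (1 + y.1 ^ 2 + y.2 ^ 2) ^ (k + 1) := by
  have hp : ∀ z : ℝ × ℝ, (1 + z.1 ^ 2 + z.2 ^ 2) ^ k ≠ 0 := fun z => by positivity
  have hd : Differentiable ℝ (fun z : ℝ × ℝ => N z / (1 + z.1 ^ 2 + z.2 ^ 2) ^ k) :=
    kw_ddiv hN (by fun_prop) hp
  refine kw_part2 hd y ((h.div ((kw_r2 y).pow k) (hp y)).congr_deriv ?_)
  have hr : (1 + y.1 ^ 2 + y.2 ^ 2) ≠ 0 := by positivity
  rcases k with _ | k
  · simp; field_simp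
  · simp
    rw [div_eq_div_iff (by positivity) (by positivity)]
    generalize 1 + y.1 ^ 2 + y.2 ^ 2 = r
    ring

/-- The key identity, for `φ = N / (1 + |y|²)` with everything given by polynomials. -/
lemma kw_poly (lam : ℝ) (w : ℝ × ℝ → ℝ) (hw : ContDiff ℝ 2 w)
    (hlap : ∀ y : ℝ × ℝ, lap w y =
      4 * lam * (1 - Real.exp (w y)) / (1 + y.1 ^ 2 + y.2 ^ 2) ^ 2)
    (C : ℝ) (hC : 0 ≤ C) (bw : ∀ y, |w y| ≤ C)
    (bp : ∀ y, |fderiv ℝ w y (1, 0)| ≤ C / (1 + y.1 ^ 2 + y.2 ^ 2))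
    (bq : ∀ y, |fderiv ℝ w y (0, 1)| ≤ C / (1 + y.1 ^ 2 + y.2 ^ 2))
    (N X Y N1 N2 X1 X2 Y1 Y2 : ℝ × ℝ → ℝ)
    (dN : Differentiable ℝ N) (dX : Differentiable ℝ X) (dY : Differentiable ℝ Y)
    (hN1 : ∀ y, HasDerivAt (fun t => N (t, y.2)) (N1 y) y.1)
    (hN2 : ∀ y, HasDerivAt (fun t => N (y.1, t)) (N2 y) y.2)
    (hX1 : ∀ y, HasDerivAt (fun t => X (t, y.2)) (X1 y) y.1)
    (hX2 : ∀ y, HasDerivAt (fun t => X (y.1, t)) (X2 y) y.2)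
    (hY1 : ∀ y, HasDerivAt (fun t => Y (t, y.2)) (Y1 y) y.1)
    (hY2 : ∀ y, HasDerivAt (fun t => Y (y.1, t)) (Y2 y) y.2)
    (a1 : ∀ y, N1 y * (1 + y.1 ^ 2 + y.2 ^ 2) - N y * (2 * y.1) = 4 * X y)
    (a2 : ∀ y, N2 y * (1 + y.1 ^ 2 + y.2 ^ 2) - N y * (2 * y.2) = 4 * Y y)
    (a3 : ∀ y, X1 y = Y2 y) (a4 : ∀ y, X2 y = - Y1 y)
    (a5 : ∀ y, (X1 y + Y2 y) * (1 + y.1 ^ 2 + y.2 ^ 2) - 4 * (y.1 * X y + y.2 * Y y) = -2 * N y)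
    (bN : ∀ y, |N y| ≤ 1 + y.1 ^ 2 + y.2 ^ 2) (bX : ∀ y, |X y| ≤ 1 + y.1 ^ 2 + y.2 ^ 2)
    (bY : ∀ y, |Y y| ≤ 1 + y.1 ^ 2 + y.2 ^ 2) :
    (lam - 2) * ∫ y, N y / (1 + y.1 ^ 2 + y.2 ^ 2) * Real.exp (w y) *
      (4 / (1 + y.1 ^ 2 + y.2 ^ 2) ^ 2) = 0 := by
  have hp : ∀ z : ℝ × ℝ, (1 + z.1 ^ 2 + z.2 ^ 2) ≠ 0 := fun z => by positivity
  have hp2 : ∀ z : ℝ × ℝ, (1 + z.1 ^ 2 + z.2 ^ 2) ^ 2 ≠ 0 := fun z => by positivity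
  refine kw_key lam w hw hlap C hC bw bp bq (fun y => N y / (1 + y.1 ^ 2 + y.2 ^ 2))
    (fun y => 4 * X y / (1 + y.1 ^ 2 + y.2 ^ 2) ^ 2)
    (fun y => 4 * Y y / (1 + y.1 ^ 2 + y.2 ^ 2) ^ 2) X Y ?_ ?_ ?_ dX dY ?_ ?_ ?_ ?_ ?_ ?_ ?_ ?_
    bX bY
  · exact kw_ddiv dN (by fun_prop) hp
  · exact kw_ddiv (dX.const_mul 4) (by fun_prop) hp2
  · exact kw_ddiv (dY.const_mul 4) (by fun_prop) hp2
  · intro y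
    have := kw_quot1 N 1 dN y _ (hN1 y)
    simp only [pow_one] at this
    rw [this, ← a1]
    simp
  · intro y
    have := kw_quot2 N 1 dN y _ (hN2 y)
    simp only [pow_one] at this
    rw [this, ← a2]
    simp
  · intro y; ring
  · intro y; ring
  · intro y
    have h1 := kw_quot1 (fun y => 4 * X y) 2 (dX.const_mul 4) y _ ((hX1 y).const_mul 4)
    have h2 := kw_quot2 (fun y => 4 * Y y) 2 (dY.const_mul 4) y _ ((hY2 y).const_mul 4)
    rw [h1, h2, ← add_div]
    have h5 := a5 y
    have h6 := hp y
    push_cast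
    generalize 1 + y.1 ^ 2 + y.2 ^ 2 = r at *
    have : -2 * (4 / r ^ 2) * (N y / r) = (-8 * N y) / r ^ (2 + 1) := by
      field_simp
      ring
    rw [this]
    congr 1
    linear_combination 4 * h5
  · intro y
    rw [kw_part1 dX y (hX1 y), kw_part2 dY y (hY2 y), a3]
  · intro y
    rw [kw_part2 dX y (hX2 y), kw_part1 dY y (hY1 y), a4]
  · intro y
    have : 0 < 1 + y.1 ^ 2 + y.2 ^ 2 := by positivity
    rw [abs_div, abs_of_pos this, div_le_one this]
    exact bN y

lemma kw_main (lam : ℝ) (u : (Fin 3 → ℝ) → ℝ) (hu : IsMFSolution lam u) (i : Fin 3) :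
    (lam - 2) * sphereIntegral (fun x => x i * Real.exp (u x)) = 0 := by
  obtain ⟨-, hN, hS, hlap, -⟩ := hu
  obtain ⟨C, hC, bw, bp, bq⟩ := kw_bounds (fun y => u (stereoN y)) (fun y => u (stereoS y))
    (hN.of_le one_le_two) (hS.of_le one_le_two)
    (fun y hy => by simp only [kw_chart y hy])
  have sq1 : ∀ t : ℝ, HasDerivAt (fun t : ℝ => t ^ 2) (2 * t) t := fun t => by
    simpa using hasDerivAt_pow 2 t
  have hid : ∀ t : ℝ, HasDerivAt (fun t : ℝ => t) 1 t := fun t => hasDerivAt_id t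
  unfold sphereIntegral
  fin_cases i
  · refine kw_poly lam _ hN hlap C hC bw bp bq (fun y => 2 * y.1)
      (fun y => (1 - y.1 ^ 2 + y.2 ^ 2) / 2) (fun y => - (y.1 * y.2))
      (fun y => 2) (fun y => 0) (fun y => - y.1) (fun y => y.2) (fun y => - y.2) (fun y => - y.1)
      (by fun_prop) (by fun_prop) (by fun_prop) ?_ ?_ ?_ ?_ ?_ ?_ ?_ ?_ ?_ ?_ ?_ ?_ ?_ ?_
    · intro y; exact ((hid y.1).const_mul 2).congr_deriv (by ring)
    · intro y; exact hasDerivAt_const y.2 (2 * y.1)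
    · intro y
      exact ((((sq1 y.1).const_sub 1).add_const (y.2 ^ 2)).div_const 2).congr_deriv (by ring)
    · intro y
      exact (((sq1 y.2).const_add (1 - y.1 ^ 2)).div_const 2).congr_deriv (by ring)
    · intro y; exact ((hid y.1).mul_const y.2).neg.congr_deriv (by ring)
    · intro y; exact ((hid y.2).const_mul y.1).neg.congr_deriv (by ring)
    · intro y; ring
    · intro y; ring
    · intro y; ring
    · intro y; ring
    · intro y; ring
    all_goals
      intro y
      rw [abs_le]
      constructor <;> nlinarith [sq_nonneg (y.1 + 1), sq_nonneg (y.1 - 1), sq_nonneg y.1,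
        sq_nonneg y.2, sq_nonneg (y.1 + y.2), sq_nonneg (y.1 - y.2)]
  · refine kw_poly lam _ hN hlap C hC bw bp bq (fun y => 2 * y.2)
      (fun y => - (y.1 * y.2)) (fun y => (1 + y.1 ^ 2 - y.2 ^ 2) / 2)
      (fun y => 0) (fun y => 2) (fun y => - y.2) (fun y => - y.1) (fun y => y.1) (fun y => - y.2)
      (by fun_prop) (by fun_prop) (by fun_prop) ?_ ?_ ?_ ?_ ?_ ?_ ?_ ?_ ?_ ?_ ?_ ?_ ?_ ?_
    · intro y; exact hasDerivAt_const y.1 (2 * y.2)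
    · intro y; exact ((hid y.2).const_mul 2).congr_deriv (by ring)
    · intro y; exact ((hid y.1).mul_const y.2).neg.congr_deriv (by ring)
    · intro y; exact ((hid y.2).const_mul y.1).neg.congr_deriv (by ring)
    · intro y
      exact ((((sq1 y.1).const_add 1).sub_const (y.2 ^ 2)).div_const 2).congr_deriv (by ring)
    · intro y
      exact (((sq1 y.2).const_sub (1 + y.1 ^ 2)).div_const 2).congr_deriv (by ring)
    · intro y; ring
    · intro y; ring
    · intro y; ring
    · intro y; ring
    · intro y; ring
    all_goals
      intro y
      rw [abs_le]
      constructor <;> nlinarith [sq_nonneg (y.2 + 1), sq_nonneg (y.2 - 1), sq_nonneg y.1,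
        sq_nonneg y.2, sq_nonneg (y.1 + y.2), sq_nonneg (y.1 - y.2)]
  · refine kw_poly lam _ hN hlap C hC bw bp bq (fun y => y.1 ^ 2 + y.2 ^ 2 - 1)
      (fun y => y.1) (fun y => y.2)
      (fun y => 2 * y.1) (fun y => 2 * y.2) (fun y => 1) (fun y => 0) (fun y => 0) (fun y => 1)
      (by fun_prop) (by fun_prop) (by fun_prop) ?_ ?_ ?_ ?_ ?_ ?_ ?_ ?_ ?_ ?_ ?_ ?_ ?_ ?_
    · intro y
      exact (((sq1 y.1).add_const (y.2 ^ 2)).sub_const 1).congr_deriv (by ring)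
    · intro y
      exact (((sq1 y.2).const_add (y.1 ^ 2)).sub_const 1).congr_deriv (by ring)
    · intro y; exact hid _
    · intro y; exact hasDerivAt_const y.2 y.1
    · intro y; exact hasDerivAt_const y.1 y.2
    · intro y; exact hid _
    · intro y; ring
    · intro y; ring
    · intro y; ring
    · intro y; ring
    · intro y; ring
    all_goals
      intro y
      rw [abs_le]
      constructor <;> nlinarith [sq_nonneg (y.1 + 1), sq_nonneg (y.1 - 1), sq_nonneg y.1,
        sq_nonneg y.2, sq_nonneg (y.2 + 1), sq_nonneg (y.2 - 1)]


/-- Kazdan–Warner integrability condition: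
`(λ - 2) ∫_{S²} xᵢ e^u dσ = 0`; in particular the integral vanishes when `λ ≠ 2`. -/
theorem kazdan_warner_first_harmonic (lam : ℝ) (u : (Fin 3 → ℝ) → ℝ)
    (hu : IsMFSolution lam u) :
    (∀ i : Fin 3,
      (lam - 2) * sphereIntegral (fun x => x i * Real.exp (u x)) = 0) ∧
    (lam ≠ 2 → ∀ i : Fin 3,
      sphereIntegral (fun x => x i * Real.exp (u x)) = 0) := by
  refine ⟨fun i => kw_main lam u hu i, fun hl i => ?_⟩
  exact (mul_eq_zero.1 (kw_main lam u hu i)).resolve_left (sub_ne_zero.2 hl)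
end
end

section
/- Let λ > 0 and let u be a solution of the mean field equation Δu = λ(1−e^u) on S². Then for all i, j, k ∈ {1,2,3}, ∫_{S²} (X_i u)(x) (X_j u)(x) (X_k u)(x) e^{u(x)} dσ(x) = 0. -/
open Real MeasureTheory

noncomputable section

/-- Rotation of ℝ³ by angle `t` about the `i`-th coordinate axis. -/
def rot (i : Fin 3) (t : ℝ) (x : Fin 3 → ℝ) : Fin 3 → ℝ :=
  if i = 0 then
    ![x 0, Real.cos t * x 1 - Real.sin t * x 2, Real.sin t * x 1 + Real.cos t * x 2]
  else if i = 1 then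
    ![Real.cos t * x 0 + Real.sin t * x 2, x 1, Real.cos t * x 2 - Real.sin t * x 0]
  else
    ![Real.cos t * x 0 - Real.sin t * x 1, Real.sin t * x 0 + Real.cos t * x 1, x 2]

/-- The rotational (Killing) vector field derivative: `Xᵢu(x) = d/dt|₀ u(Rᵢ(t)x)`. -/
def killingDeriv (i : Fin 3) (u : (Fin 3 → ℝ) → ℝ) (x : Fin 3 → ℝ) : ℝ :=
  deriv (fun t => u (rot i t x)) 0


open Filter Topology

/-- The conformal denominator. -/
def qq (y : ℝ × ℝ) : ℝ := 1 + y.1 ^ 2 + y.2 ^ 2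

lemma qq_one_le (y : ℝ × ℝ) : 1 ≤ qq y := by unfold qq; nlinarith [sq_nonneg y.1, sq_nonneg y.2]

lemma qq_pos (y : ℝ × ℝ) : 0 < qq y := lt_of_lt_of_le one_pos (qq_one_le y)

lemma qq_cont : Continuous qq := by unfold qq; fun_prop

lemma sqrt_qq_one_le (y : ℝ × ℝ) : 1 ≤ √(qq y) := by
  rw [Real.one_le_sqrt]; exact qq_one_le y

lemma sqrt_qq_le (y : ℝ × ℝ) : √(qq y) ≤ qq y := by
  have h := Real.mul_self_sqrt (qq_pos y).le
  nlinarith [sqrt_qq_one_le y]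

lemma abs_fst_le (y : ℝ × ℝ) : |y.1| ≤ √(qq y) := by
  apply Real.abs_le_sqrt; unfold qq; nlinarith [sq_nonneg y.2]

lemma abs_snd_le (y : ℝ × ℝ) : |y.2| ≤ √(qq y) := by
  apply Real.abs_le_sqrt; unfold qq; nlinarith [sq_nonneg y.1]

lemma integrable_of_qq {G : ℝ × ℝ → ℝ} (hG : Continuous G) (C : ℝ)
    (h : ∀ y, |G y| ≤ C / (qq y * √(qq y))) : Integrable G := by
  have h0 : Integrable (fun y : ℝ × ℝ => C * ((1 : ℝ) + ‖y‖ ^ 2) ^ (-(3 : ℝ) / 2)) := by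
    apply Integrable.const_mul
    apply integrable_rpow_neg_one_add_norm_sq
    simp; norm_num
  have hC : 0 ≤ C := by
    have h1 := (abs_nonneg _).trans (h 0)
    have : (0:ℝ) < qq 0 * √(qq 0) := mul_pos (qq_pos 0) (Real.sqrt_pos.2 (qq_pos 0))
    by_contra hc
    push Not at hc
    linarith [div_neg_of_neg_of_pos hc this]
  refine h0.mono' hG.aestronglyMeasurable (Eventually.of_forall fun y => ?_)
  refine (h y).trans ?_
  rw [div_eq_mul_inv]
  refine mul_le_mul_of_nonneg_left ?_ hC
  have e : (qq y * √(qq y))⁻¹ = (qq y) ^ (-(3 : ℝ) / 2) := by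
    rw [Real.sqrt_eq_rpow, ← Real.rpow_one_add' (qq_pos y).le (by norm_num), ← Real.rpow_neg (qq_pos y).le]
    norm_num
  rw [e]
  apply Real.rpow_le_rpow_of_nonpos (by positivity) _ (by norm_num)
  unfold qq
  rcases le_total ‖y.1‖ ‖y.2‖ with h1 | h1
  · rw [Prod.norm_def, max_eq_right h1, Real.norm_eq_abs, sq_abs]; nlinarith [sq_nonneg y.1]
  · rw [Prod.norm_def, max_eq_left h1, Real.norm_eq_abs, sq_abs]; nlinarith [sq_nonneg y.2]

lemma integral_deriv_fst_zero (W W' : ℝ × ℝ → ℝ)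
    (hW : ∀ a b, HasDerivAt (fun a => W (a, b)) (W' (a, b)) a)
    (hIntg : Integrable W') (C : ℝ) (hb : ∀ y, |W y| ≤ C / qq y) : ∫ y, W' y = 0 := by
  have key : ∀ᵐ b : ℝ, ∫ a, W' (a, b) = 0 := by
    have hIntg' : Integrable W' ((volume : Measure ℝ).prod volume) := hIntg
    filter_upwards [hIntg'.prod_left_ae] with b hb1
    have hq : Tendsto (fun a : ℝ => |a|) (cocompact ℝ) atTop := tendsto_norm_cocompact_atTop
    have hz : Tendsto (fun a : ℝ => C / qq (a, b)) (cocompact ℝ) (𝓝 0) := by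
      apply Tendsto.div_atTop tendsto_const_nhds
      refine tendsto_atTop_mono (fun a => ?_) hq
      unfold qq
      simp only
      rw [← sq_abs a]
      nlinarith [sq_nonneg (|a| - 1), sq_nonneg b]
    have hw : Tendsto (fun a : ℝ => W (a, b)) (cocompact ℝ) (𝓝 0) :=
      squeeze_zero_norm (fun a => hb (a, b)) hz
    rw [integral_of_hasDerivAt_of_tendsto (fun a => hW a b) hb1
      (hw.mono_left atBot_le_cocompact) (hw.mono_left atTop_le_cocompact)]
    simp
  have : ∫ y, W' y = ∫ b, ∫ a, W' (a, b) := by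
    rw [Measure.volume_eq_prod]
    exact integral_prod_symm _ hIntg
  rw [this, integral_congr_ae key]
  simp

/-- Derivative of `4 V f / q²` in the first variable. -/
def wfst (V V' f f' : ℝ × ℝ → ℝ) (y : ℝ × ℝ) : ℝ :=
  (4 * V' y / qq y ^ 2 - 16 * y.1 * V y / qq y ^ 3) * f y + 4 * V y / qq y ^ 2 * f' y

lemma dir_fst (V V' f f' : ℝ × ℝ → ℝ) (C : ℝ)
    (cV : Continuous V) (cV' : Continuous V') (cf : Continuous f) (cf' : Continuous f')
    (hV : ∀ a b, HasDerivAt (fun a => V (a, b)) (V' (a, b)) a)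
    (hf : ∀ a b, HasDerivAt (fun a => f (a, b)) (f' (a, b)) a)
    (bV : ∀ y, |V y| ≤ qq y) (bV' : ∀ y, |V' y| ≤ √(qq y))
    (bf : ∀ y, |f y| ≤ C) (bf' : ∀ y, |f' y| ≤ C / qq y) :
    Integrable (wfst V V' f f') ∧ ∫ y, wfst V V' f f' y = 0 := by
  have hC : 0 ≤ C := (abs_nonneg _).trans (bf 0)
  have hIntg : Integrable (wfst V V' f f') := by
    apply integrable_of_qq (C := 24 * C)
    · unfold wfst
      have := qq_cont
      have h0 : ∀ y, qq y ≠ 0 := fun y => (qq_pos y).ne'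
      fun_prop (disch := intro y; exact pow_ne_zero _ (h0 y))
    · intro y
      unfold wfst
      have q1 := qq_pos y
      have s1 := sqrt_qq_one_le y
      have s2 : √(qq y) * √(qq y) = qq y := Real.mul_self_sqrt q1.le
      set s := √(qq y) with hs
      have s0 : 0 < s := by linarith
      have e1 : |4 * V' y / qq y ^ 2| ≤ 4 / (qq y * s) := by
        rw [abs_div, abs_of_pos (pow_pos q1 2), abs_mul, abs_of_pos (by norm_num : (0:ℝ) < 4)]
        rw [div_le_div_iff₀ (by positivity) (by positivity)]
        have := bV' y
        calc 4 * |V' y| * (qq y * s) ≤ 4 * s * (qq y * s) := by gcongr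
          _ = 4 * qq y ^ 2 := by rw [← s2]; ring
      have e2 : |16 * y.1 * V y / qq y ^ 3| ≤ 16 / (qq y * s) := by
        rw [abs_div, abs_of_pos (pow_pos q1 3), abs_mul, abs_mul, abs_of_pos (by norm_num : (0:ℝ) < 16)]
        rw [div_le_div_iff₀ (by positivity) (by positivity)]
        have h1 := abs_fst_le y
        have h2 := bV y
        calc 16 * |y.1| * |V y| * (qq y * s) ≤ 16 * s * qq y * (qq y * s) := by gcongr
          _ = 16 * qq y ^ 3 := by
            rw [show 16 * s * qq y * (qq y * s) = 16 * qq y ^ 2 * (s * s) by ring, s2]; ring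
      have e3 : |4 * V y / qq y ^ 2 * f' y| ≤ 4 * C / (qq y * s) := by
        rw [abs_mul, abs_div, abs_of_pos (pow_pos q1 2), abs_mul, abs_of_pos (by norm_num : (0:ℝ) < 4)]
        have h2 := bV y
        calc 4 * |V y| / qq y ^ 2 * |f' y| ≤ 4 * qq y / qq y ^ 2 * (C / qq y) := by
              gcongr; exact bf' y
          _ = 4 * C / (qq y * qq y) := by field_simp
          _ ≤ 4 * C / (qq y * s) := by
              gcongr; exact sqrt_qq_le y
      calc _ ≤ (|4 * V' y / qq y ^ 2| + |16 * y.1 * V y / qq y ^ 3|) * |f y|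
            + |4 * V y / qq y ^ 2 * f' y| := by
              refine (abs_add_le _ _).trans ?_
              rw [abs_mul]
              gcongr
              exact abs_sub _ _
        _ ≤ (4 / (qq y * s) + 16 / (qq y * s)) * C + 4 * C / (qq y * s) := by
              gcongr; exact bf y
        _ = _ := by ring
  refine ⟨hIntg, ?_⟩
  apply integral_deriv_fst_zero (fun y => 4 * V y / qq y ^ 2 * f y) _ _ hIntg (4 * C)
  · intro y
    rw [abs_mul, abs_div, abs_of_pos (pow_pos (qq_pos y) 2), abs_mul, abs_of_pos (by norm_num : (0:ℝ) < 4)]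
    have h2 := bV y
    have q1 := qq_pos y
    calc 4 * |V y| / qq y ^ 2 * |f y| ≤ 4 * qq y / qq y ^ 2 * C := by
          gcongr; exact bf y
      _ = 4 * C / qq y := by field_simp
  · intro a b
    have q1 := (qq_pos (a, b)).ne'
    have hq : HasDerivAt (fun a => qq (a, b)) (2 * a) a := by
      unfold qq
      simp only
      have := ((hasDerivAt_pow 2 a).const_add 1).add_const (b ^ 2)
      simpa using this
    have := ((((hV a b).const_mul 4).div (hq.pow 2) (pow_ne_zero 2 q1)).mul (hf a b))
    refine this.congr_deriv ?_
    unfold wfst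
    simp only [Pi.mul_apply, Pi.div_apply, Pi.pow_apply]
    field_simp
    ring

/-- Derivative of `4 V f / q²` in the second variable. -/
def wsnd (V V' f f' : ℝ × ℝ → ℝ) (y : ℝ × ℝ) : ℝ :=
  (4 * V' y / qq y ^ 2 - 16 * y.2 * V y / qq y ^ 3) * f y + 4 * V y / qq y ^ 2 * f' y

lemma qq_swap (y : ℝ × ℝ) : qq y.swap = qq y := by unfold qq; simp; ring

lemma dir_snd (V V' f f' : ℝ × ℝ → ℝ) (C : ℝ)
    (cV : Continuous V) (cV' : Continuous V') (cf : Continuous f) (cf' : Continuous f')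
    (hV : ∀ a b, HasDerivAt (fun b => V (a, b)) (V' (a, b)) b)
    (hf : ∀ a b, HasDerivAt (fun b => f (a, b)) (f' (a, b)) b)
    (bV : ∀ y, |V y| ≤ qq y) (bV' : ∀ y, |V' y| ≤ √(qq y))
    (bf : ∀ y, |f y| ≤ C) (bf' : ∀ y, |f' y| ≤ C / qq y) :
    Integrable (wsnd V V' f f') ∧ ∫ y, wsnd V V' f f' y = 0 := by
  have h := dir_fst (V ∘ Prod.swap) (V' ∘ Prod.swap) (f ∘ Prod.swap) (f' ∘ Prod.swap) C
    (cV.comp continuous_swap) (cV'.comp continuous_swap) (cf.comp continuous_swap)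
    (cf'.comp continuous_swap) (fun a b => hV b a) (fun a b => hf b a)
    (fun y => by rw [← qq_swap]; exact bV _) (fun y => by rw [← qq_swap]; exact bV' _)
    (fun y => bf _) (fun y => by rw [← qq_swap]; exact bf' _)
  have e : wfst (V ∘ Prod.swap) (V' ∘ Prod.swap) (f ∘ Prod.swap) (f' ∘ Prod.swap)
      = wsnd V V' f f' ∘ Prod.swap := by
    funext y
    simp [wfst, wsnd, qq_swap]
  rw [e] at h
  constructor
  · have := h.1.swap
    exact this
  · rw [← h.2]
    exact (integral_prod_swap (μ := (volume : Measure ℝ)) (ν := (volume : Measure ℝ)) (wsnd V V' f f')).symm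


/-- Complement of the origin in `ℝ³`. -/
def OO : Set (Fin 3 → ℝ) := {0}ᶜ

lemma OO_open : IsOpen OO := isOpen_compl_singleton

lemma sphere3_sub : sphere3 ⊆ OO := by
  intro x hx h0
  simp only [Set.mem_singleton_iff] at h0
  subst h0
  simp [sphere3] at hx

lemma stereoN_mem (y : ℝ × ℝ) : stereoN y ∈ sphere3 := by
  have h := (qq_pos y).ne'
  unfold qq at h
  simp [sphere3, stereoN]
  field_simp
  ring

lemma stereoN_OO (y : ℝ × ℝ) : stereoN y ∈ OO := sphere3_sub (stereoN_mem y)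

lemma sphere3_compact : IsCompact sphere3 := by
  apply Metric.isCompact_of_isClosed_isBounded
  · exact isClosed_eq (by fun_prop) (by fun_prop)
  · refine (Metric.isBounded_closedBall (x := (0 : Fin 3 → ℝ)) (r := 1)).subset ?_
    intro x hx
    rw [mem_closedBall_zero_iff, pi_norm_le_iff_of_nonneg zero_le_one]
    intro i
    rw [Real.norm_eq_abs, ← sq_le_one_iff_abs_le_one]
    have hx' : x 0 ^ 2 + x 1 ^ 2 + x 2 ^ 2 = 1 := hx
    fin_cases i
    · change x 0 ^ 2 ≤ 1
      nlinarith [sq_nonneg (x 0), sq_nonneg (x 1), sq_nonneg (x 2)]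
    · change x 1 ^ 2 ≤ 1
      nlinarith [sq_nonneg (x 0), sq_nonneg (x 1), sq_nonneg (x 2)]
    · change x 2 ^ 2 ≤ 1
      nlinarith [sq_nonneg (x 0), sq_nonneg (x 1), sq_nonneg (x 2)]

lemma stereoN_cont : Continuous stereoN := by
  unfold stereoN
  have h : ∀ y : ℝ × ℝ, 1 + y.1 ^ 2 + y.2 ^ 2 ≠ 0 := fun y => (qq_pos y).ne'
  refine continuous_pi fun i => ?_
  fin_cases i <;> simp <;> fun_prop (disch := exact h)

/-- First partial derivative of the stereographic parametrization. -/
def dN1 (y : ℝ × ℝ) : Fin 3 → ℝ :=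
  ![2 / qq y - 4 * y.1 ^ 2 / qq y ^ 2, - 4 * y.1 * y.2 / qq y ^ 2, 4 * y.1 / qq y ^ 2]

/-- Second partial derivative of the stereographic parametrization. -/
def dN2 (y : ℝ × ℝ) : Fin 3 → ℝ :=
  ![- 4 * y.1 * y.2 / qq y ^ 2, 2 / qq y - 4 * y.2 ^ 2 / qq y ^ 2, 4 * y.2 / qq y ^ 2]

lemma dN1_cont : Continuous dN1 := by
  unfold dN1
  have := qq_cont
  have h : ∀ y, qq y ≠ 0 := fun y => (qq_pos y).ne'
  have h2 : ∀ y, qq y ^ 2 ≠ 0 := fun y => pow_ne_zero 2 (h y)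
  refine continuous_pi fun i => ?_
  fin_cases i <;> simp <;> fun_prop (disch := simp [h])

lemma dN2_cont : Continuous dN2 := by
  unfold dN2
  have := qq_cont
  have h : ∀ y, qq y ≠ 0 := fun y => (qq_pos y).ne'
  have h2 : ∀ y, qq y ^ 2 ≠ 0 := fun y => pow_ne_zero 2 (h y)
  refine continuous_pi fun i => ?_
  fin_cases i <;> simp <;> fun_prop (disch := simp [h])

lemma qq_deriv1 (a b : ℝ) : HasDerivAt (fun a : ℝ => 1 + a ^ 2 + b ^ 2) (2 * a) a := by
  have := ((hasDerivAt_pow 2 a).const_add 1).add_const (b ^ 2)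
  simpa using this

lemma qq_deriv2 (a b : ℝ) : HasDerivAt (fun b : ℝ => 1 + a ^ 2 + b ^ 2) (2 * b) b := by
  have := ((hasDerivAt_pow 2 b).const_add (1 + a ^ 2))
  simpa using this

lemma stereoN_deriv1 (a b : ℝ) : HasDerivAt (fun a => stereoN (a, b)) (dN1 (a, b)) a := by
  have h : 1 + a ^ 2 + b ^ 2 ≠ 0 := (qq_pos (a, b)).ne'
  have hq := qq_deriv1 a b
  rw [hasDerivAt_pi]
  intro i
  fin_cases i
  · have := (((hasDerivAt_id a).const_mul 2).div hq h)
    refine HasDerivAt.congr_deriv this ?_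
    simp [dN1, qq]; field_simp; ring
  · have := (((hasDerivAt_const a (2 * b))).div hq h)
    refine HasDerivAt.congr_deriv this ?_
    simp [dN1, qq]; field_simp; ring
  · have := ((((hasDerivAt_pow 2 a).add_const (b ^ 2)).sub_const 1).div hq h)
    refine HasDerivAt.congr_deriv this ?_
    simp [dN1, qq]; field_simp; ring

lemma stereoN_deriv2 (a b : ℝ) : HasDerivAt (fun b => stereoN (a, b)) (dN2 (a, b)) b := by
  have h : 1 + a ^ 2 + b ^ 2 ≠ 0 := (qq_pos (a, b)).ne'
  have hq := qq_deriv2 a b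
  rw [hasDerivAt_pi]
  intro i
  fin_cases i
  · have := (((hasDerivAt_const b (2 * a))).div hq h)
    refine HasDerivAt.congr_deriv this ?_
    simp [dN2, qq]; field_simp; ring
  · have := (((hasDerivAt_id b).const_mul 2).div hq h)
    refine HasDerivAt.congr_deriv this ?_
    simp [dN2, qq]; field_simp; ring
  · have := ((((hasDerivAt_pow 2 b).const_add (a ^ 2)).sub_const 1).div hq h)
    refine HasDerivAt.congr_deriv this ?_
    simp [dN2, qq]; field_simp; ring

lemma dN1_norm (y : ℝ × ℝ) : ‖dN1 y‖ ≤ 6 / qq y := by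
  have q1 := qq_pos y
  have q0 := qq_one_le y
  rw [pi_norm_le_iff_of_nonneg (by positivity)]
  have hq : qq y = 1 + y.1 ^ 2 + y.2 ^ 2 := rfl
  intro i
  rw [Real.norm_eq_abs]
  fin_cases i
  · simp only [dN1, Fin.zero_eta, Matrix.cons_val_zero]
    rw [show 2 / qq y - 4 * y.1 ^ 2 / qq y ^ 2 = (2 * qq y - 4 * y.1 ^ 2) / qq y ^ 2 by field_simp,
      abs_div, abs_of_pos (pow_pos q1 2), div_le_div_iff₀ (by positivity) q1]
    have : |2 * qq y - 4 * y.1 ^ 2| ≤ 6 * qq y := by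
      rw [abs_le]; constructor <;> nlinarith [sq_nonneg y.1, sq_nonneg y.2]
    nlinarith
  · simp only [dN1, Fin.mk_one, Matrix.cons_val_one, Matrix.cons_val_zero]
    rw [abs_div, abs_of_pos (pow_pos q1 2), div_le_div_iff₀ (by positivity) q1]
    have : |-4 * y.1 * y.2| ≤ 6 * qq y := by
      rw [abs_le]; constructor <;> nlinarith [sq_nonneg (y.1 - y.2), sq_nonneg (y.1 + y.2)]
    nlinarith
  · simp only [dN1, Fin.reduceFinMk, Matrix.cons_val]
    rw [abs_div, abs_of_pos (pow_pos q1 2), div_le_div_iff₀ (by positivity) q1]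
    have : |4 * y.1| ≤ 6 * qq y := by
      rw [abs_le]; constructor <;> nlinarith [sq_nonneg (y.1 - 1), sq_nonneg (y.1 + 1), sq_nonneg y.2]
    nlinarith

lemma dN2_norm (y : ℝ × ℝ) : ‖dN2 y‖ ≤ 6 / qq y := by
  have q1 := qq_pos y
  have q0 := qq_one_le y
  rw [pi_norm_le_iff_of_nonneg (by positivity)]
  have hq : qq y = 1 + y.1 ^ 2 + y.2 ^ 2 := rfl
  intro i
  rw [Real.norm_eq_abs]
  fin_cases i
  · simp only [dN2, Fin.zero_eta, Matrix.cons_val_zero]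
    rw [abs_div, abs_of_pos (pow_pos q1 2), div_le_div_iff₀ (by positivity) q1]
    have : |-4 * y.1 * y.2| ≤ 6 * qq y := by
      rw [abs_le]; constructor <;> nlinarith [sq_nonneg (y.1 - y.2), sq_nonneg (y.1 + y.2)]
    nlinarith
  · simp only [dN2, Fin.mk_one, Matrix.cons_val_one, Matrix.cons_val_zero]
    rw [show 2 / qq y - 4 * y.2 ^ 2 / qq y ^ 2 = (2 * qq y - 4 * y.2 ^ 2) / qq y ^ 2 by field_simp,
      abs_div, abs_of_pos (pow_pos q1 2), div_le_div_iff₀ (by positivity) q1]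
    have : |2 * qq y - 4 * y.2 ^ 2| ≤ 6 * qq y := by
      rw [abs_le]; constructor <;> nlinarith [sq_nonneg y.1, sq_nonneg y.2]
    nlinarith
  · simp only [dN2, Fin.reduceFinMk, Matrix.cons_val]
    rw [abs_div, abs_of_pos (pow_pos q1 2), div_le_div_iff₀ (by positivity) q1]
    have : |4 * y.2| ≤ 6 * qq y := by
      rw [abs_le]; constructor <;> nlinarith [sq_nonneg (y.2 - 1), sq_nonneg (y.2 + 1), sq_nonneg y.1]
    nlinarith

/-- Infinitesimal rotations. -/
def xi (i : Fin 3) (x : Fin 3 → ℝ) : Fin 3 → ℝ :=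
  if i = 0 then ![0, - x 2, x 1] else if i = 1 then ![x 2, 0, - x 0] else ![- x 1, x 0, 0]

/-- Killing derivative via the Fréchet derivative. -/
def Xd (i : Fin 3) (F : (Fin 3 → ℝ) → ℝ) (x : Fin 3 → ℝ) : ℝ := fderiv ℝ F x (xi i x)

/-- First component of the Killing field in the chart. -/
def V1 (i : Fin 3) (y : ℝ × ℝ) : ℝ :=
  if i = 0 then y.1 * y.2 else if i = 1 then (y.2 ^ 2 - y.1 ^ 2 - 1) / 2 else - y.2

/-- Second component of the Killing field in the chart. -/
def V2 (i : Fin 3) (y : ℝ × ℝ) : ℝ :=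
  if i = 0 then (1 - y.1 ^ 2 + y.2 ^ 2) / 2 else if i = 1 then - (y.1 * y.2) else y.1

/-- `∂₁ V1`. -/
def V11 (i : Fin 3) (y : ℝ × ℝ) : ℝ := if i = 0 then y.2 else if i = 1 then - y.1 else 0

/-- `∂₂ V1`. -/
def V12 (i : Fin 3) (y : ℝ × ℝ) : ℝ := if i = 0 then y.1 else if i = 1 then y.2 else - 1

/-- `∂₁ V2`. -/
def V21 (i : Fin 3) (y : ℝ × ℝ) : ℝ := if i = 0 then - y.1 else if i = 1 then - y.2 else 1

/-- `∂₂ V2`. -/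
def V22 (i : Fin 3) (y : ℝ × ℝ) : ℝ := if i = 0 then y.2 else if i = 1 then - y.1 else 0

lemma V1_cont (i : Fin 3) : Continuous (V1 i) := by
  unfold V1; fin_cases i <;> simp <;> fun_prop
lemma V2_cont (i : Fin 3) : Continuous (V2 i) := by
  unfold V2; fin_cases i <;> simp <;> fun_prop
lemma V11_cont (i : Fin 3) : Continuous (V11 i) := by
  unfold V11; fin_cases i <;> simp <;> fun_prop
lemma V22_cont (i : Fin 3) : Continuous (V22 i) := by
  unfold V22; fin_cases i <;> simp <;> fun_prop

lemma sq_deriv (a : ℝ) : HasDerivAt (fun a : ℝ => a ^ 2) (2 * a) a := by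
  simpa using hasDerivAt_pow 2 a

lemma V1_deriv1 (i : Fin 3) (a b : ℝ) : HasDerivAt (fun a => V1 i (a, b)) (V11 i (a, b)) a := by
  unfold V1 V11; fin_cases i <;> simp
  · simpa using (hasDerivAt_id a).mul_const b
  · exact ((((sq_deriv a).const_sub (b ^ 2)).sub_const 1).div_const 2).congr_deriv (by ring)
  · exact hasDerivAt_const _ _

lemma V1_deriv2 (i : Fin 3) (a b : ℝ) : HasDerivAt (fun b => V1 i (a, b)) (V12 i (a, b)) b := by
  unfold V1 V12; fin_cases i <;> simp
  · simpa using (hasDerivAt_id b).const_mul a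
  · exact ((((sq_deriv b).sub_const (a ^ 2)).sub_const 1).div_const 2).congr_deriv (by ring)
  · exact (hasDerivAt_id b).neg

lemma V2_deriv1 (i : Fin 3) (a b : ℝ) : HasDerivAt (fun a => V2 i (a, b)) (V21 i (a, b)) a := by
  unfold V2 V21; fin_cases i <;> simp
  · exact ((((sq_deriv a).const_sub 1).add_const (b ^ 2)).div_const 2).congr_deriv (by ring)
  · exact ((hasDerivAt_id a).mul_const b).neg.congr_deriv (by ring)
  · exact (hasDerivAt_id a)

lemma V2_deriv2 (i : Fin 3) (a b : ℝ) : HasDerivAt (fun b => V2 i (a, b)) (V22 i (a, b)) b := by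
  unfold V2 V22; fin_cases i <;> simp
  · exact (((sq_deriv b).const_add (1 - a ^ 2)).div_const 2).congr_deriv (by ring)
  · exact ((hasDerivAt_id b).const_mul a).neg.congr_deriv (by ring)
  · exact hasDerivAt_const _ _

lemma V1_bound (i : Fin 3) (y : ℝ × ℝ) : |V1 i y| ≤ qq y := by
  unfold V1 qq; fin_cases i <;> simp only [Fin.zero_eta, Fin.mk_one, Fin.reduceFinMk, if_true, one_ne_zero, if_false, Fin.reduceEq] <;> rw [abs_le] <;> constructor <;>
    nlinarith [sq_nonneg (y.1 - y.2), sq_nonneg (y.1 + y.2), sq_nonneg y.1, sq_nonneg y.2, sq_nonneg (y.2 - 1), sq_nonneg (y.2 + 1)]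

lemma V2_bound (i : Fin 3) (y : ℝ × ℝ) : |V2 i y| ≤ qq y := by
  unfold V2 qq; fin_cases i <;> simp only [Fin.zero_eta, Fin.mk_one, Fin.reduceFinMk, if_true, one_ne_zero, if_false, Fin.reduceEq] <;> rw [abs_le] <;> constructor <;>
    nlinarith [sq_nonneg (y.1 - y.2), sq_nonneg (y.1 + y.2), sq_nonneg y.1, sq_nonneg y.2, sq_nonneg (y.1 - 1), sq_nonneg (y.1 + 1)]

lemma V11_bound (i : Fin 3) (y : ℝ × ℝ) : |V11 i y| ≤ √(qq y) := by
  unfold V11; fin_cases i <;> simp [abs_fst_le, abs_snd_le]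

lemma V22_bound (i : Fin 3) (y : ℝ × ℝ) : |V22 i y| ≤ √(qq y) := by
  unfold V22; fin_cases i <;> simp [abs_fst_le, abs_snd_le]

lemma xi_stereoN (i : Fin 3) (y : ℝ × ℝ) :
    xi i (stereoN y) = V1 i y • dN1 y + V2 i y • dN2 y := by
  have h : 1 + y.1 ^ 2 + y.2 ^ 2 ≠ 0 := (qq_pos y).ne'
  funext k
  fin_cases i <;> fin_cases k <;> simp [xi, V1, V2, dN1, dN2, stereoN, qq] <;> field_simp <;> ring

lemma fderiv_cont {F : (Fin 3 → ℝ) → ℝ} (hF : ContDiffOn ℝ 1 F OO) :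
    ContinuousOn (fderiv ℝ F) OO := hF.continuousOn_fderiv_of_isOpen OO_open le_rfl

lemma hasF {F : (Fin 3 → ℝ) → ℝ} (hF : ContDiffOn ℝ 1 F OO) {x : Fin 3 → ℝ} (hx : x ∈ OO) :
    HasFDerivAt F (fderiv ℝ F x) x :=
  ((hF.contDiffAt (OO_open.mem_nhds hx)).differentiableAt one_ne_zero).hasFDerivAt

lemma comp_deriv1 {F : (Fin 3 → ℝ) → ℝ} (hF : ContDiffOn ℝ 1 F OO) (a b : ℝ) :
    HasDerivAt (fun a => F (stereoN (a, b))) (fderiv ℝ F (stereoN (a, b)) (dN1 (a, b))) a :=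
  (hasF hF (stereoN_OO (a, b))).comp_hasDerivAt a (stereoN_deriv1 a b)

lemma comp_deriv2 {F : (Fin 3 → ℝ) → ℝ} (hF : ContDiffOn ℝ 1 F OO) (a b : ℝ) :
    HasDerivAt (fun b => F (stereoN (a, b))) (fderiv ℝ F (stereoN (a, b)) (dN2 (a, b))) b :=
  (hasF hF (stereoN_OO (a, b))).comp_hasDerivAt b (stereoN_deriv2 a b)

lemma Xd_stereoN (i : Fin 3) (F : (Fin 3 → ℝ) → ℝ) (y : ℝ × ℝ) :
    Xd i F (stereoN y) = V1 i y * fderiv ℝ F (stereoN y) (dN1 y)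
      + V2 i y * fderiv ℝ F (stereoN y) (dN2 y) := by
  unfold Xd
  rw [xi_stereoN]
  simp

lemma cont_stereoN {F : (Fin 3 → ℝ) → ℝ} (hF : ContinuousOn F OO) :
    Continuous (fun y => F (stereoN y)) :=
  hF.comp_continuous stereoN_cont stereoN_OO

lemma sphere_int {F : (Fin 3 → ℝ) → ℝ} (hF : ContinuousOn F OO) :
    Integrable (fun y : ℝ × ℝ => F (stereoN y) * (4 / (1 + y.1 ^ 2 + y.2 ^ 2) ^ 2)) := by
  obtain ⟨C, hC⟩ := sphere3_compact.exists_bound_of_continuousOn (hF.mono sphere3_sub)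
  have h : ∀ y : ℝ × ℝ, (1 + y.1 ^ 2 + y.2 ^ 2) ≠ 0 := fun y => (qq_pos y).ne'
  apply integrable_of_qq (C := C * 4)
  · refine (cont_stereoN hF).mul ?_
    exact Continuous.div (by fun_prop) (by fun_prop) (fun y => pow_ne_zero _ (h y))
  · intro y
    have h1 := hC _ (stereoN_mem y)
    have hC0 : 0 ≤ C := (norm_nonneg _).trans h1
    change |F (stereoN y) * (4 / (qq y) ^ 2)| ≤ _
    have q1 := qq_pos y
    have s1 := sqrt_qq_one_le y
    rw [abs_mul, abs_of_pos (by positivity : 0 < 4 / (qq y) ^ 2), mul_div_assoc]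
    rw [Real.norm_eq_abs] at h1
    gcongr
    rw [sq]
    gcongr
    exact sqrt_qq_le y

lemma sphere_Xd_zero (i : Fin 3) {F : (Fin 3 → ℝ) → ℝ} (hF : ContDiffOn ℝ 1 F OO) :
    sphereIntegral (Xd i F) = 0 := by
  obtain ⟨C, hC⟩ := sphere3_compact.exists_bound_of_continuousOn (hF.continuousOn.mono sphere3_sub)
  obtain ⟨D, hD⟩ := sphere3_compact.exists_bound_of_continuousOn ((fderiv_cont hF).mono sphere3_sub)
  have cf := cont_stereoN hF.continuousOn
  have cd : Continuous (fun y => fderiv ℝ F (stereoN y)) :=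
    (fderiv_cont hF).comp_continuous stereoN_cont stereoN_OO
  have hC0 : 0 ≤ C := (norm_nonneg _).trans (hC _ (stereoN_mem 0))
  have hD0 : 0 ≤ D := (norm_nonneg _).trans (hD _ (stereoN_mem 0))
  have b0 : ∀ y, |F (stereoN y)| ≤ C + 6 * D := fun y => (hC _ (stereoN_mem y)).trans (by linarith)
  have b1 : ∀ y, |fderiv ℝ F (stereoN y) (dN1 y)| ≤ (C + 6 * D) / qq y := by
    intro y
    have q1 := qq_pos y
    refine ((fderiv ℝ F (stereoN y)).le_opNorm (dN1 y)).trans ?_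
    calc _ ≤ D * (6 / qq y) := by
          gcongr
          · exact hD _ (stereoN_mem y)
          · exact dN1_norm y
      _ = (6 * D) / qq y := by ring
      _ ≤ _ := by gcongr; linarith
  have b2 : ∀ y, |fderiv ℝ F (stereoN y) (dN2 y)| ≤ (C + 6 * D) / qq y := by
    intro y
    have q1 := qq_pos y
    refine ((fderiv ℝ F (stereoN y)).le_opNorm (dN2 y)).trans ?_
    calc _ ≤ D * (6 / qq y) := by
          gcongr
          · exact hD _ (stereoN_mem y)
          · exact dN2_norm y
      _ = (6 * D) / qq y := by ring
      _ ≤ _ := by gcongr; linarith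
  have h1 := dir_fst (V1 i) (V11 i) (fun y => F (stereoN y))
    (fun y => fderiv ℝ F (stereoN y) (dN1 y)) _ (V1_cont i) (V11_cont i) cf (cd.clm_apply dN1_cont)
    (V1_deriv1 i) (comp_deriv1 hF) (V1_bound i) (V11_bound i) b0 b1
  have h2 := dir_snd (V2 i) (V22 i) (fun y => F (stereoN y))
    (fun y => fderiv ℝ F (stereoN y) (dN2 y)) _ (V2_cont i) (V22_cont i) cf (cd.clm_apply dN2_cont)
    (V2_deriv2 i) (comp_deriv2 hF) (V2_bound i) (V22_bound i) b0 b2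
  have := integral_add h1.1 h2.1
  rw [h1.2, h2.2, add_zero] at this
  rw [← this]
  unfold sphereIntegral
  congr 1
  funext y
  rw [Xd_stereoN]
  simp only [wfst, wsnd]
  change _ * (4 / (qq y) ^ 2) = _
  have q1 := (qq_pos y).ne'
  have hdiv : V11 i y * qq y - 4 * y.1 * V1 i y + (V22 i y * qq y - 4 * y.2 * V2 i y) = 0 := by
    fin_cases i <;> simp [V1, V2, V11, V22, qq] <;> ring
  field_simp
  linear_combination (-4 * F (stereoN y)) * hdiv


lemma rot_zero_apply (i : Fin 3) (x : Fin 3 → ℝ) : rot i 0 x = x := by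
  funext k; fin_cases i <;> fin_cases k <;> simp [rot]

lemma rot_neg_rot (i : Fin 3) (t : ℝ) (x : Fin 3 → ℝ) : rot i (-t) (rot i t x) = x := by
  have h := Real.sin_sq_add_cos_sq t
  funext k; fin_cases i <;> fin_cases k <;> simp [rot]
  · linear_combination (x 1) * h
  · linear_combination (x 2) * h
  · linear_combination (x 0) * h
  · linear_combination (x 2) * h
  · linear_combination (x 0) * h
  · linear_combination (x 1) * h

lemma rot_rot_neg (i : Fin 3) (t : ℝ) (x : Fin 3 → ℝ) : rot i t (rot i (-t) x) = x := by
  simpa using rot_neg_rot i (-t) x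

/-- Rotation as a continuous linear map. -/
def rotL (i : Fin 3) (t : ℝ) : (Fin 3 → ℝ) →L[ℝ] (Fin 3 → ℝ) :=
  LinearMap.toContinuousLinearMap
    { toFun := rot i t
      map_add' := by
        intro x y
        funext k; fin_cases i <;> fin_cases k <;> simp [rot] <;> ring
      map_smul' := by
        intro c x
        funext k; fin_cases i <;> fin_cases k <;> simp [rot] <;> ring }

lemma rotL_apply (i : Fin 3) (t : ℝ) (x : Fin 3 → ℝ) : rotL i t x = rot i t x := rfl

lemma rot_OO (i : Fin 3) (t : ℝ) {x : Fin 3 → ℝ} (hx : x ∈ OO) : rot i t x ∈ OO := by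
  intro h
  apply hx
  have h' : rot i t x = 0 := h
  have := rot_neg_rot i t x
  rw [h', ← rotL_apply, map_zero] at this
  exact this.symm

lemma rot_contDiff (i : Fin 3) {n : WithTop ℕ∞} :
    ContDiff ℝ n (fun p : ℝ × (Fin 3 → ℝ) => rot i p.1 p.2) := by
  have hc : ContDiff ℝ n (fun p : ℝ × (Fin 3 → ℝ) => Real.cos p.1) :=
    Real.contDiff_cos.comp contDiff_fst
  have hs : ContDiff ℝ n (fun p : ℝ × (Fin 3 → ℝ) => Real.sin p.1) :=
    Real.contDiff_sin.comp contDiff_fst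
  have hx : ∀ k, ContDiff ℝ n (fun p : ℝ × (Fin 3 → ℝ) => p.2 k) := fun k =>
    (contDiff_apply ℝ ℝ k).comp contDiff_snd
  rw [contDiff_pi]
  intro k
  fin_cases i <;> fin_cases k <;> simp [rot] <;>
    first
    | exact hx _
    | exact ((hc.mul (hx _)).sub (hs.mul (hx _)))
    | exact ((hc.mul (hx _)).add (hs.mul (hx _)))
    | exact ((hs.mul (hx _)).add (hc.mul (hx _)))

lemma rot_hasDerivAt (i : Fin 3) (t : ℝ) (x : Fin 3 → ℝ) :
    HasDerivAt (fun t => rot i t x) (xi i (rot i t x)) t := by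
  have hc := Real.hasDerivAt_cos t
  have hs := Real.hasDerivAt_sin t
  rw [hasDerivAt_pi]
  intro k
  fin_cases i <;> fin_cases k <;> simp [rot, xi] <;>
    first
    | exact hasDerivAt_const _ _
    | exact ((hc.mul_const _).sub (hs.mul_const _)).congr_deriv (by ring)
    | exact ((hc.mul_const _).add (hs.mul_const _)).congr_deriv (by ring)
    | exact ((hs.mul_const _).add (hc.mul_const _)).congr_deriv (by ring)

lemma rot_xi_self (i : Fin 3) (t : ℝ) (x : Fin 3 → ℝ) : rot i t (xi i x) = xi i (rot i t x) := by
  funext k; fin_cases i <;> fin_cases k <;> simp [rot, xi] <;> ring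

lemma fderiv_comp_rot (i : Fin 3) (t : ℝ) {F : (Fin 3 → ℝ) → ℝ} (hF : ContDiffOn ℝ 1 F OO)
    {x : Fin 3 → ℝ} (hx : x ∈ OO) (v : Fin 3 → ℝ) :
    fderiv ℝ (fun x => F (rot i t x)) x v = fderiv ℝ F (rot i t x) (rot i t v) := by
  have h := (hasF hF (rot_OO i t hx)).comp x (rotL i t).hasFDerivAt
  have e : HasFDerivAt (fun x => F (rot i t x)) ((fderiv ℝ F (rot i t x)).comp (rotL i t)) x := h
  rw [e.fderiv]
  rfl

lemma contDiffOn_comp_rot (i : Fin 3) (t : ℝ) {n : WithTop ℕ∞} {F : (Fin 3 → ℝ) → ℝ}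
    (hF : ContDiffOn ℝ n F OO) : ContDiffOn ℝ n (fun x => F (rot i t x)) OO :=
  hF.comp (rotL i t).contDiff.contDiffOn (fun _ hx => rot_OO i t hx)

lemma hasDerivAt_rot (i : Fin 3) (t : ℝ) {F : (Fin 3 → ℝ) → ℝ} (hF : ContDiffOn ℝ 1 F OO)
    {x : Fin 3 → ℝ} (hx : x ∈ OO) :
    HasDerivAt (fun t => F (rot i t x)) (Xd i F (rot i t x)) t :=
  (hasF hF (rot_OO i t hx)).comp_hasDerivAt t (rot_hasDerivAt i t x)

lemma sphere_congr {F G : (Fin 3 → ℝ) → ℝ} (h : ∀ x ∈ sphere3, F x = G x) :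
    sphereIntegral F = sphereIntegral G := by
  unfold sphereIntegral
  congr 1
  funext y
  rw [h _ (stereoN_mem y)]

lemma sphere_hasDerivAt (H : ℝ → (Fin 3 → ℝ) → ℝ)
    (hH : ContDiffOn ℝ 1 (fun p : ℝ × (Fin 3 → ℝ) => H p.1 p.2) (Set.univ ×ˢ OO)) (r₀ : ℝ) :
    HasDerivAt (fun r => sphereIntegral (H r))
      (sphereIntegral (fun x => deriv (fun r => H r x) r₀)) r₀ := by
  set G : ℝ × (Fin 3 → ℝ) → ℝ := fun p => H p.1 p.2 with hG
  have ho : IsOpen ((Set.univ : Set ℝ) ×ˢ OO) := isOpen_univ.prod OO_open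
  have hc : ContinuousOn (fderiv ℝ G) (Set.univ ×ˢ OO) :=
    hH.continuousOn_fderiv_of_isOpen ho le_rfl
  have hc1 : ContinuousOn (fun p => fderiv ℝ G p (1, 0)) (Set.univ ×ˢ OO) :=
    hc.clm_apply continuousOn_const
  have hd : ∀ r, ∀ x ∈ OO, HasDerivAt (fun r => H r x) (fderiv ℝ G (r, x) (1, 0)) r := by
    intro r x hx
    have h1 : HasFDerivAt G (fderiv ℝ G (r, x)) (r, x) :=
      ((hH.contDiffAt (ho.mem_nhds ⟨trivial, hx⟩)).differentiableAt one_ne_zero).hasFDerivAt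
    exact h1.comp_hasDerivAt r ((hasDerivAt_id r).prodMk (hasDerivAt_const r x))
  obtain ⟨C, hC⟩ := ((isCompact_closedBall r₀ 1).prod sphere3_compact).exists_bound_of_continuousOn
    (hc1.mono (Set.prod_mono (Set.subset_univ _) sphere3_sub))
  have hslice : ∀ r, ContinuousOn (H r) OO := fun r =>
    hH.continuousOn.comp (f := fun x => (r, x)) (by fun_prop) (fun x hx => ⟨trivial, hx⟩)
  have hslice' : ∀ r, ContinuousOn (fun x => fderiv ℝ G (r, x) (1, 0)) OO := fun r =>
    hc1.comp (f := fun x => (r, x)) (by fun_prop) (fun x hx => ⟨trivial, hx⟩)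
  have e : sphereIntegral (fun x => deriv (fun r => H r x) r₀)
      = sphereIntegral (fun x => fderiv ℝ G (r₀, x) (1, 0)) :=
    sphere_congr fun x hx => (hd r₀ x (sphere3_sub hx)).deriv
  rw [e]
  refine (hasDerivAt_integral_of_dominated_loc_of_deriv_le
    (F := fun r (y : ℝ × ℝ) => H r (stereoN y) * (4 / (1 + y.1 ^ 2 + y.2 ^ 2) ^ 2))
    (F' := fun r (y : ℝ × ℝ) => fderiv ℝ G (r, stereoN y) (1, 0) * (4 / (1 + y.1 ^ 2 + y.2 ^ 2) ^ 2))
    (bound := fun y => C * (4 / (1 + y.1 ^ 2 + y.2 ^ 2) ^ 2))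
    (Metric.closedBall_mem_nhds r₀ one_pos)
    (Eventually.of_forall fun r => (sphere_int (hslice r)).aestronglyMeasurable)
    (sphere_int (hslice r₀)) (sphere_int (hslice' r₀)).aestronglyMeasurable
    (Eventually.of_forall fun y r hr => ?_)
    (sphere_int (F := fun _ => C) continuousOn_const)
    (Eventually.of_forall fun y r hr => (hd r _ (stereoN_OO y)).mul_const _)).2
  have := hC (r, stereoN y) ⟨hr, stereoN_mem y⟩
  rw [norm_mul]
  rw [Real.norm_of_nonneg (by positivity : 0 ≤ 4 / (1 + y.1 ^ 2 + y.2 ^ 2) ^ 2)]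
  gcongr

lemma sphere_deriv_zero (H : ℝ → (Fin 3 → ℝ) → ℝ) (H' : (Fin 3 → ℝ) → ℝ)
    (hH : ContDiffOn ℝ 1 (fun p : ℝ × (Fin 3 → ℝ) => H p.1 p.2) (Set.univ ×ˢ OO))
    (h0 : ∀ r, sphereIntegral (H r) = 0)
    (hd : ∀ x ∈ sphere3, HasDerivAt (fun r => H r x) (H' x) 0) : sphereIntegral H' = 0 := by
  have h1 := sphere_hasDerivAt H hH 0
  have h2 : (fun r => sphereIntegral (H r)) = fun _ => 0 := funext h0
  rw [h2] at h1
  rw [sphere_congr (G := fun x => deriv (fun r => H r x) 0) fun x hx => (hd x hx).deriv.symm]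
  exact h1.unique (hasDerivAt_const _ _)

lemma contDiffOn_rot_joint (i : Fin 3) {n : WithTop ℕ∞} {F : (Fin 3 → ℝ) → ℝ}
    (hF : ContDiffOn ℝ n F OO) :
    ContDiffOn ℝ n (fun p : ℝ × (Fin 3 → ℝ) => F (rot i p.1 p.2)) (Set.univ ×ˢ OO) :=
  hF.comp (rot_contDiff i).contDiffOn (fun _ hx => rot_OO i _ hx.2)

lemma sphere_rot (i : Fin 3) (t : ℝ) {F : (Fin 3 → ℝ) → ℝ} (hF : ContDiffOn ℝ 1 F OO) :
    sphereIntegral (fun x => F (rot i t x)) = sphereIntegral F := by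
  have h : ∀ t, HasDerivAt (fun t => sphereIntegral (fun x => F (rot i t x))) 0 t := by
    intro t
    refine (sphere_hasDerivAt (fun t x => F (rot i t x)) (contDiffOn_rot_joint i hF) t).congr_deriv ?_
    rw [← sphere_Xd_zero i (contDiffOn_comp_rot i t hF)]
    apply sphere_congr
    intro x hx
    have hx' := sphere3_sub hx
    rw [(hasDerivAt_rot i t hF hx').deriv]
    unfold Xd
    rw [fderiv_comp_rot i t hF hx', rot_xi_self]
  have := is_const_of_deriv_eq_zero (fun t => (h t).differentiableAt) (fun t => (h t).deriv) t 0
  simpa [rot_zero_apply] using this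

/-- The carré du champ. -/
def Gam (a b : (Fin 3 → ℝ) → ℝ) (x : Fin 3 → ℝ) : ℝ :=
  Xd 0 a x * Xd 0 b x + Xd 1 a x * Xd 1 b x + Xd 2 a x * Xd 2 b x

lemma rot0_xi (t : ℝ) (x : Fin 3 → ℝ) :
    rot 0 t (xi 0 x) = xi 0 (rot 0 t x) ∧
    rot 0 t (xi 1 x) = Real.cos t • xi 1 (rot 0 t x) + Real.sin t • xi 2 (rot 0 t x) ∧
    rot 0 t (xi 2 x) = (- Real.sin t) • xi 1 (rot 0 t x) + Real.cos t • xi 2 (rot 0 t x) := by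
  have h := Real.sin_sq_add_cos_sq t
  refine ⟨rot_xi_self 0 t x, ?_, ?_⟩ <;> funext k <;> fin_cases k <;> simp [rot, xi] <;>
    first
    | ring1
    | linear_combination (x 0) * h
    | linear_combination (-x 0) * h
    | linear_combination (x 1) * h
    | linear_combination (-x 1) * h
    | linear_combination (x 2) * h
    | linear_combination (-x 2) * h

lemma rot1_xi (t : ℝ) (x : Fin 3 → ℝ) :
    rot 1 t (xi 1 x) = xi 1 (rot 1 t x) ∧
    rot 1 t (xi 2 x) = Real.cos t • xi 2 (rot 1 t x) + Real.sin t • xi 0 (rot 1 t x) ∧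
    rot 1 t (xi 0 x) = (- Real.sin t) • xi 2 (rot 1 t x) + Real.cos t • xi 0 (rot 1 t x) := by
  have h := Real.sin_sq_add_cos_sq t
  refine ⟨rot_xi_self 1 t x, ?_, ?_⟩ <;> funext k <;> fin_cases k <;> simp [rot, xi] <;>
    first
    | ring1
    | linear_combination (x 0) * h
    | linear_combination (-x 0) * h
    | linear_combination (x 1) * h
    | linear_combination (-x 1) * h
    | linear_combination (x 2) * h
    | linear_combination (-x 2) * h

lemma rot2_xi (t : ℝ) (x : Fin 3 → ℝ) :
    rot 2 t (xi 2 x) = xi 2 (rot 2 t x) ∧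
    rot 2 t (xi 0 x) = Real.cos t • xi 0 (rot 2 t x) + Real.sin t • xi 1 (rot 2 t x) ∧
    rot 2 t (xi 1 x) = (- Real.sin t) • xi 0 (rot 2 t x) + Real.cos t • xi 1 (rot 2 t x) := by
  have h := Real.sin_sq_add_cos_sq t
  refine ⟨rot_xi_self 2 t x, ?_, ?_⟩ <;> funext k <;> fin_cases k <;> simp [rot, xi] <;>
    first
    | ring1
    | linear_combination (x 0) * h
    | linear_combination (-x 0) * h
    | linear_combination (x 1) * h
    | linear_combination (-x 1) * h
    | linear_combination (x 2) * h
    | linear_combination (-x 2) * h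

lemma Gam_rot (i : Fin 3) (t : ℝ) {a b : (Fin 3 → ℝ) → ℝ} (ha : ContDiffOn ℝ 1 a OO)
    (hb : ContDiffOn ℝ 1 b OO) {x : Fin 3 → ℝ} (hx : x ∈ OO) :
    Gam (fun x => a (rot i t x)) (fun x => b (rot i t x)) x = Gam a b (rot i t x) := by
  have h := Real.sin_sq_add_cos_sq t
  unfold Gam Xd
  simp only [fderiv_comp_rot i t ha hx, fderiv_comp_rot i t hb hx]
  fin_cases i
  · obtain ⟨h0, h1, h2⟩ := rot0_xi t x
    simp only [Fin.zero_eta, h0, h1, h2, map_add, map_smul, smul_eq_mul]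
    generalize fderiv ℝ a _ = α
    generalize fderiv ℝ b _ = β
    linear_combination (α (xi 1 (rot 0 t x)) * β (xi 1 (rot 0 t x)) + α (xi 2 (rot 0 t x)) * β (xi 2 (rot 0 t x))) * h
  · obtain ⟨h0, h1, h2⟩ := rot1_xi t x
    simp only [Fin.mk_one, h0, h1, h2, map_add, map_smul, smul_eq_mul]
    generalize fderiv ℝ a _ = α
    generalize fderiv ℝ b _ = β
    linear_combination (α (xi 0 (rot 1 t x)) * β (xi 0 (rot 1 t x)) + α (xi 2 (rot 1 t x)) * β (xi 2 (rot 1 t x))) * h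
  · obtain ⟨h0, h1, h2⟩ := rot2_xi t x
    simp only [Fin.reduceFinMk, h0, h1, h2, map_add, map_smul, smul_eq_mul]
    generalize fderiv ℝ a _ = α
    generalize fderiv ℝ b _ = β
    linear_combination (α (xi 1 (rot 2 t x)) * β (xi 1 (rot 2 t x)) + α (xi 0 (rot 2 t x)) * β (xi 0 (rot 2 t x))) * h


lemma sphere_congr' {F G : (Fin 3 → ℝ) → ℝ} (h : ∀ y, F (stereoN y) = G (stereoN y)) :
    sphereIntegral F = sphereIntegral G := by
  unfold sphereIntegral
  congr 1
  funext y
  rw [h y]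

lemma sphere_add {F G : (Fin 3 → ℝ) → ℝ} (hF : ContinuousOn F OO) (hG : ContinuousOn G OO) :
    sphereIntegral (fun x => F x + G x) = sphereIntegral F + sphereIntegral G := by
  unfold sphereIntegral
  rw [← integral_add (sphere_int hF) (sphere_int hG)]
  congr 1
  funext y
  ring

lemma sphere_sub {F G : (Fin 3 → ℝ) → ℝ} (hF : ContinuousOn F OO) (hG : ContinuousOn G OO) :
    sphereIntegral (fun x => F x - G x) = sphereIntegral F - sphereIntegral G := by
  unfold sphereIntegral
  rw [← integral_sub (sphere_int hF) (sphere_int hG)]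
  congr 1
  funext y
  ring

lemma sphere_const_mul (c : ℝ) (F : (Fin 3 → ℝ) → ℝ) :
    sphereIntegral (fun x => c * F x) = c * sphereIntegral F := by
  unfold sphereIntegral
  rw [← integral_const_mul]
  congr 1
  funext y
  ring

lemma xi_contDiff (i : Fin 3) {n : WithTop ℕ∞} : ContDiff ℝ n (xi i) := by
  rw [contDiff_pi]
  intro k
  fin_cases i <;> fin_cases k <;> simp [xi] <;>
    first
    | exact contDiff_const
    | exact contDiff_apply ℝ ℝ _
    | exact (contDiff_apply ℝ ℝ _).neg

lemma Xd_contDiffOn (i : Fin 3) {F : (Fin 3 → ℝ) → ℝ} (hF : ContDiffOn ℝ 2 F OO) :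
    ContDiffOn ℝ 1 (Xd i F) OO :=
  (hF.fderiv_of_isOpen OO_open (m := 1) (by norm_num)).clm_apply (xi_contDiff i).contDiffOn

lemma Xd_continuousOn (i : Fin 3) {F : (Fin 3 → ℝ) → ℝ} (hF : ContDiffOn ℝ 1 F OO) :
    ContinuousOn (Xd i F) OO :=
  (fderiv_cont hF).clm_apply (xi_contDiff (n := 0) i).continuous.continuousOn

lemma Xd_mul (i : Fin 3) {F G : (Fin 3 → ℝ) → ℝ} (hF : ContDiffOn ℝ 1 F OO)
    (hG : ContDiffOn ℝ 1 G OO) {x : Fin 3 → ℝ} (hx : x ∈ OO) :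
    Xd i (fun x => F x * G x) x = F x * Xd i G x + Xd i F x * G x := by
  unfold Xd
  have : HasFDerivAt (fun x => F x * G x) (F x • fderiv ℝ G x + G x • fderiv ℝ F x) x :=
    (hasF hF hx).mul (hasF hG hx)
  rw [this.fderiv]
  simp
  ring

/-- Spherical Laplacian as the sum of squares of Killing fields. -/
def LapX (U : (Fin 3 → ℝ) → ℝ) (x : Fin 3 → ℝ) : ℝ :=
  Xd 0 (Xd 0 U) x + Xd 1 (Xd 1 U) x + Xd 2 (Xd 2 U) x

lemma weak_form {U ψ : (Fin 3 → ℝ) → ℝ} (hU : ContDiffOn ℝ 2 U OO) (hψ : ContDiffOn ℝ 1 ψ OO) :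
    sphereIntegral (fun x => ψ x * LapX U x) = - sphereIntegral (Gam ψ U) := by
  have hU1 : ContDiffOn ℝ 1 U OO := hU.of_le (by norm_num)
  have c1 : ∀ i, ContinuousOn (fun x => ψ x * Xd i (Xd i U) x) OO := fun i =>
    hψ.continuousOn.mul (Xd_continuousOn i (Xd_contDiffOn i hU))
  have c2 : ∀ i, ContinuousOn (fun x => Xd i ψ x * Xd i U x) OO := fun i =>
    (Xd_continuousOn i hψ).mul (Xd_continuousOn i hU1)
  have z : ∀ i, sphereIntegral (fun x => ψ x * Xd i (Xd i U) x)
      + sphereIntegral (fun x => Xd i ψ x * Xd i U x) = 0 := by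
    intro i
    rw [← sphere_add (c1 i) (c2 i), ← sphere_Xd_zero i (hψ.mul (Xd_contDiffOn i hU))]
    exact sphere_congr fun x hx => (Xd_mul i hψ (Xd_contDiffOn i hU) (sphere3_sub hx)).symm
  have e1 : sphereIntegral (fun x => ψ x * LapX U x) =
      sphereIntegral (fun x => ψ x * Xd 0 (Xd 0 U) x) + sphereIntegral (fun x => ψ x * Xd 1 (Xd 1 U) x)
      + sphereIntegral (fun x => ψ x * Xd 2 (Xd 2 U) x) := by
    rw [← sphere_add (c1 0) (c1 1), 
      ← sphere_add (F := fun x => ψ x * Xd 0 (Xd 0 U) x + ψ x * Xd 1 (Xd 1 U) x) ((c1 0).add (c1 1)) (c1 2)]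
    exact sphere_congr fun x _ => by simp only [LapX]; ring
  have e2 : sphereIntegral (Gam ψ U) =
      sphereIntegral (fun x => Xd 0 ψ x * Xd 0 U x) + sphereIntegral (fun x => Xd 1 ψ x * Xd 1 U x)
      + sphereIntegral (fun x => Xd 2 ψ x * Xd 2 U x) := by
    rw [← sphere_add (c2 0) (c2 1), 
      ← sphere_add (F := fun x => Xd 0 ψ x * Xd 0 U x + Xd 1 ψ x * Xd 1 U x) ((c2 0).add (c2 1)) (c2 2)]
    rfl
  rw [e1, e2]
  linarith [z 0, z 1, z 2]

/-- Maps that behave like rotations. -/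
structure IsRot (Q : (Fin 3 → ℝ) → (Fin 3 → ℝ)) : Prop where
  maps : ∀ x ∈ OO, Q x ∈ OO
  smooth : ContDiff ℝ 2 Q
  integ : ∀ F : (Fin 3 → ℝ) → ℝ, ContDiffOn ℝ 1 F OO →
    sphereIntegral (fun x => F (Q x)) = sphereIntegral F
  gam : ∀ a b : (Fin 3 → ℝ) → ℝ, ContDiffOn ℝ 1 a OO → ContDiffOn ℝ 1 b OO → ∀ x ∈ OO,
    Gam (fun x => a (Q x)) (fun x => b (Q x)) x = Gam a b (Q x)

lemma isRot_rot (i : Fin 3) (t : ℝ) : IsRot (rot i t) where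
  maps := fun _ hx => rot_OO i t hx
  smooth := (rotL i t).contDiff
  integ := fun _ hF => sphere_rot i t hF
  gam := fun _ _ ha hb _ hx => Gam_rot i t ha hb hx

lemma IsRot.contDiffOn {Q : (Fin 3 → ℝ) → (Fin 3 → ℝ)} (hQ : IsRot Q) {n : WithTop ℕ∞} (hn : n ≤ 2)
    {F : (Fin 3 → ℝ) → ℝ} (hF : ContDiffOn ℝ n F OO) : ContDiffOn ℝ n (fun x => F (Q x)) OO :=
  hF.comp (hQ.smooth.of_le hn).contDiffOn hQ.maps

lemma IsRot.comp {Q P : (Fin 3 → ℝ) → (Fin 3 → ℝ)} (hQ : IsRot Q) (hP : IsRot P) :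
    IsRot (fun x => Q (P x)) where
  maps := fun x hx => hQ.maps _ (hP.maps x hx)
  smooth := hQ.smooth.comp hP.smooth
  integ := fun F hF => by
    rw [hP.integ (fun x => F (Q x)) (hQ.contDiffOn (by norm_num) hF), hQ.integ F hF]
  gam := fun a b ha hb x hx => by
    rw [hP.gam (fun x => a (Q x)) (fun x => b (Q x)) (hQ.contDiffOn (by norm_num) ha)
      (hQ.contDiffOn (by norm_num) hb) x hx, hQ.gam a b ha hb _ (hP.maps x hx)]

lemma Gam_contDiffOn {a b : (Fin 3 → ℝ) → ℝ} (ha : ContDiffOn ℝ 2 a OO) (hb : ContDiffOn ℝ 2 b OO) :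
    ContDiffOn ℝ 1 (Gam a b) OO :=
  (((Xd_contDiffOn 0 ha).mul (Xd_contDiffOn 0 hb)).add
    ((Xd_contDiffOn 1 ha).mul (Xd_contDiffOn 1 hb))).add
    ((Xd_contDiffOn 2 ha).mul (Xd_contDiffOn 2 hb))

lemma Gam_comm (a b : (Fin 3 → ℝ) → ℝ) : Gam a b = Gam b a := by
  funext x; unfold Gam; ring

lemma symm_id {lam : ℝ} (hl : lam ≠ 0) {U : (Fin 3 → ℝ) → ℝ} (hU : ContDiffOn ℝ 2 U OO)
    (hL : ∀ y, LapX U (stereoN y) = lam * (1 - Real.exp (U (stereoN y))))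
    {Q Q' : (Fin 3 → ℝ) → (Fin 3 → ℝ)} (hQ : IsRot Q) (hQ' : IsRot Q')
    (h1 : ∀ x, Q' (Q x) = x) (h2 : ∀ x, Q (Q' x) = x) :
    sphereIntegral (fun x => (1 - Real.exp (U x)) * U (Q x) - (1 - Real.exp (U (Q x))) * U x) = 0 := by
  have hU1 : ContDiffOn ℝ 1 U OO := hU.of_le (by norm_num)
  have w : ∀ P, IsRot P → lam * sphereIntegral (fun x => (1 - Real.exp (U x)) * U (P x))
      = - sphereIntegral (Gam (fun x => U (P x)) U) := by
    intro P hP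
    rw [← weak_form hU (hP.contDiffOn (by norm_num) hU1), ← sphere_const_mul]
    exact sphere_congr' fun y => by simp only [hL]; ring
  have g : sphereIntegral (Gam (fun x => U (Q x)) U) = sphereIntegral (Gam (fun x => U (Q' x)) U) := by
    rw [← hQ'.integ _ (Gam_contDiffOn (hQ.contDiffOn le_rfl hU) hU)]
    apply sphere_congr
    intro x hx
    rw [← hQ'.gam _ _ (hQ.contDiffOn (by norm_num) hU1) hU1 x (sphere3_sub hx), Gam_comm]
    simp only [h2]
  have e : sphereIntegral (fun x => (1 - Real.exp (U x)) * U (Q x))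
      = sphereIntegral (fun x => (1 - Real.exp (U x)) * U (Q' x)) := by
    have a := w Q hQ
    rw [g, ← w Q' hQ'] at a
    exact mul_left_cancel₀ hl a
  have s1 : ∀ P, IsRot P → ContDiffOn ℝ 1 (fun x => (1 - Real.exp (U x)) * U (P x)) OO :=
    fun P hP => (contDiffOn_const.sub hU1.exp).mul (hP.contDiffOn (by norm_num) hU1)
  have e2 : sphereIntegral (fun x => (1 - Real.exp (U x)) * U (Q' x))
      = sphereIntegral (fun x => (1 - Real.exp (U (Q x))) * U x) := by
    rw [← hQ.integ _ (s1 Q' hQ')]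
    simp only [h1]
  have s2 : ContDiffOn ℝ 1 (fun x => (1 - Real.exp (U (Q x))) * U x) OO :=
    (contDiffOn_const.sub (hQ.contDiffOn (by norm_num) hU1).exp).mul hU1
  rw [sphere_sub (s1 Q hQ).continuousOn s2.continuousOn, e, e2, sub_self]

lemma three_param {lam : ℝ} (hl : lam ≠ 0) {U : (Fin 3 → ℝ) → ℝ} (hU : ContDiffOn ℝ 2 U OO)
    (hL : ∀ y, LapX U (stereoN y) = lam * (1 - Real.exp (U (stereoN y))))
    (i j k : Fin 3) (r t s : ℝ) :
    sphereIntegral (fun x => (1 - Real.exp (U (rot i r x))) * U (rot j t (rot k s x))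
      - (1 - Real.exp (U (rot j t (rot k s x)))) * U (rot i r x)) = 0 := by
  have hU1 : ContDiffOn ℝ 1 U OO := hU.of_le (by norm_num)
  have hQ := (isRot_rot j t).comp ((isRot_rot k s).comp (isRot_rot i (-r)))
  have hQ' := ((isRot_rot i r).comp (isRot_rot k (-s))).comp (isRot_rot j (-t))
  have h := symm_id hl hU hL hQ hQ' (fun x => by simp only [rot_neg_rot, rot_rot_neg])
    (fun x => by simp only [rot_neg_rot, rot_rot_neg])
  rw [← (isRot_rot i r).integ _ (((contDiffOn_const.sub hU1.exp).mul (hQ.contDiffOn (by norm_num) hU1)).sub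
    ((contDiffOn_const.sub (hQ.contDiffOn (by norm_num) hU1).exp).mul hU1))] at h
  simpa only [rot_neg_rot] using h

lemma joint_snd {F : (Fin 3 → ℝ) → ℝ} {n : WithTop ℕ∞} (hF : ContDiffOn ℝ n F OO) :
    ContDiffOn ℝ n (fun p : ℝ × (Fin 3 → ℝ) => F p.2) (Set.univ ×ˢ OO) :=
  hF.comp contDiff_snd.contDiffOn (fun _ hx => hx.2)

lemma cubic {lam : ℝ} (hl : lam ≠ 0) {U : (Fin 3 → ℝ) → ℝ} (hU : ContDiffOn ℝ 2 U OO)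
    (hL : ∀ y, LapX U (stereoN y) = lam * (1 - Real.exp (U (stereoN y)))) (i j k : Fin 3) :
    sphereIntegral (fun x => Xd i U x * Xd j U x * Xd k U x * Real.exp (U x)) = 0 := by
  have hU1 : ContDiffOn ℝ 1 U OO := hU.of_le (by norm_num)
  -- differentiate in r
  have A : ∀ t s, sphereIntegral (fun x => -(Real.exp (U x) * Xd i U x) * U (rot j t (rot k s x))
      - (1 - Real.exp (U (rot j t (rot k s x)))) * Xd i U x) = 0 := by
    intro t s
    have hG : ContDiffOn ℝ 1 (fun x => U (rot j t (rot k s x))) OO :=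
      contDiffOn_comp_rot k s (contDiffOn_comp_rot j t hU1)
    refine sphere_deriv_zero (fun r x => (1 - Real.exp (U (rot i r x))) * U (rot j t (rot k s x))
      - (1 - Real.exp (U (rot j t (rot k s x)))) * U (rot i r x)) _ ?_
      (fun r => three_param hl hU hL i j k r t s) ?_
    · exact ((contDiffOn_const.sub (contDiffOn_rot_joint i hU1).exp).mul (joint_snd hG)).sub
        ((contDiffOn_const.sub (joint_snd hG).exp).mul (contDiffOn_rot_joint i hU1))
    · intro x hx
      have d := hasDerivAt_rot i 0 hU1 (sphere3_sub hx)
      refine (((d.exp.const_sub 1).mul_const _).sub (d.const_mul _)).congr_deriv ?_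
      simp only [rot_zero_apply]
  -- differentiate in t
  have B : ∀ s, sphereIntegral (fun x => -(Real.exp (U x) * Xd i U x) * Xd j U (rot k s x)
      + (Real.exp (U (rot k s x)) * Xd j U (rot k s x)) * Xd i U x) = 0 := by
    intro s
    have hv := Xd_contDiffOn i hU
    have hK : ContDiffOn ℝ 1 (fun p : ℝ × (Fin 3 → ℝ) => U (rot j p.1 (rot k s p.2)))
        (Set.univ ×ˢ OO) := by
      refine (contDiffOn_rot_joint j hU1).comp
        (f := fun p : ℝ × (Fin 3 → ℝ) => (p.1, rot k s p.2)) ?_ ?_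
      · exact (contDiff_fst.prodMk ((rotL k s).contDiff.comp contDiff_snd)).contDiffOn
      · exact fun p hp => ⟨trivial, rot_OO k s hp.2⟩
    refine sphere_deriv_zero (fun t x => -(Real.exp (U x) * Xd i U x) * U (rot j t (rot k s x))
      - (1 - Real.exp (U (rot j t (rot k s x)))) * Xd i U x) _ ?_ (fun t => A t s) ?_
    · exact ((joint_snd (hU1.exp.mul hv).neg).mul hK).sub
        ((contDiffOn_const.sub hK.exp).mul (joint_snd hv))
    · intro x hx
      have d := hasDerivAt_rot j 0 hU1 (rot_OO k s (sphere3_sub hx))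
      refine ((d.const_mul _).sub ((d.exp.const_sub 1).mul_const _)).congr_deriv ?_
      simp only [rot_zero_apply]
      ring
  -- differentiate in s
  have hv := Xd_contDiffOn i hU
  have hw := Xd_contDiffOn j hU
  refine sphere_deriv_zero (fun s x => -(Real.exp (U x) * Xd i U x) * Xd j U (rot k s x)
      + (Real.exp (U (rot k s x)) * Xd j U (rot k s x)) * Xd i U x) _ ?_ B ?_
  · exact ((joint_snd (hU1.exp.mul hv).neg).mul (contDiffOn_rot_joint k hw)).add
      (((contDiffOn_rot_joint k hU1).exp.mul (contDiffOn_rot_joint k hw)).mul (joint_snd hv))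
  · intro x hx
    have d := hasDerivAt_rot k 0 hU1 (sphere3_sub hx)
    have d2 := hasDerivAt_rot k 0 hw (sphere3_sub hx)
    refine ((d2.const_mul _).add ((d.exp.mul d2).mul_const _)).congr_deriv ?_
    simp only [rot_zero_apply]
    ring


lemma lap_chart {U : (Fin 3 → ℝ) → ℝ} (hU : ContDiffOn ℝ 2 U OO)
    (hw : ContDiff ℝ 2 (fun y => U (stereoN y))) (y : ℝ × ℝ) :
    LapX U (stereoN y) = (1 + y.1 ^ 2 + y.2 ^ 2) ^ 2 / 4 * lap (fun y => U (stereoN y)) y := by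
  have hU1 : ContDiffOn ℝ 1 U OO := hU.of_le (by norm_num)
  set w : ℝ × ℝ → ℝ := fun y => U (stereoN y) with hwd
  have hdw : ∀ y, HasFDerivAt w (fderiv ℝ w y) y := fun y =>
    (hw.differentiable (by norm_num) y).hasFDerivAt
  have hl1 : ∀ a b : ℝ, HasDerivAt (fun a : ℝ => ((a, b) : ℝ × ℝ)) (1, 0) a := fun a b =>
    (hasDerivAt_id a).prodMk (hasDerivAt_const a b)
  have hl2 : ∀ a b : ℝ, HasDerivAt (fun b : ℝ => ((a, b) : ℝ × ℝ)) (0, 1) b := fun a b =>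
    (hasDerivAt_const b a).prodMk (hasDerivAt_id b)
  have p1 : ∀ y, fderiv ℝ U (stereoN y) (dN1 y) = fderiv ℝ w y (1, 0) := by
    rintro ⟨a, b⟩
    have h := HasFDerivAt.comp_hasDerivAt (f := fun a : ℝ => ((a, b) : ℝ × ℝ)) a (hdw (a, b)) (hl1 a b)
    exact (comp_deriv1 hU1 a b).unique h
  have p2 : ∀ y, fderiv ℝ U (stereoN y) (dN2 y) = fderiv ℝ w y (0, 1) := by
    rintro ⟨a, b⟩
    have h := HasFDerivAt.comp_hasDerivAt (f := fun b : ℝ => ((a, b) : ℝ × ℝ)) b (hdw (a, b)) (hl2 a b)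
    exact (comp_deriv2 hU1 a b).unique h
  have hX : ∀ i y, Xd i U (stereoN y) = V1 i y * fderiv ℝ w y (1, 0) + V2 i y * fderiv ℝ w y (0, 1) := by
    intro i y
    rw [Xd_stereoN, p1, p2]
  have hw2 : ∀ y, HasFDerivAt (fderiv ℝ w) (fderiv ℝ (fderiv ℝ w) y) y := fun y =>
    ((hw.fderiv_right (m := 1) (by norm_num)).differentiable one_ne_zero y).hasFDerivAt
  have s1 : ∀ v : ℝ × ℝ, ∀ a b, HasDerivAt (fun a => fderiv ℝ w (a, b) v)
      (fderiv ℝ (fderiv ℝ w) (a, b) (1, 0) v) a := by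
    intro v a b
    have h1 : HasDerivAt (fun a => fderiv ℝ w (a, b)) _ a :=
      (hw2 (a, b)).comp_hasDerivAt a (hl1 a b)
    exact ((ContinuousLinearMap.apply ℝ ℝ v).hasFDerivAt (x := fderiv ℝ w (a, b))).comp_hasDerivAt a h1
  have s2 : ∀ v : ℝ × ℝ, ∀ a b, HasDerivAt (fun b => fderiv ℝ w (a, b) v)
      (fderiv ℝ (fderiv ℝ w) (a, b) (0, 1) v) b := by
    intro v a b
    have h1 : HasDerivAt (fun b => fderiv ℝ w (a, b)) _ b :=
      (hw2 (a, b)).comp_hasDerivAt b (hl2 a b)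
    exact ((ContinuousLinearMap.apply ℝ ℝ v).hasFDerivAt (x := fderiv ℝ w (a, b))).comp_hasDerivAt b h1
  obtain ⟨a, b⟩ := y
  have q1 : ∀ i, fderiv ℝ (Xd i U) (stereoN (a, b)) (dN1 (a, b)) =
      (V11 i (a, b) * fderiv ℝ w (a, b) (1, 0) + V1 i (a, b) * fderiv ℝ (fderiv ℝ w) (a, b) (1, 0) (1, 0))
      + (V21 i (a, b) * fderiv ℝ w (a, b) (0, 1) + V2 i (a, b) * fderiv ℝ (fderiv ℝ w) (a, b) (1, 0) (0, 1)) := by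
    intro i
    have h := comp_deriv1 (Xd_contDiffOn i hU) a b
    simp only [hX] at h
    exact h.unique (((V1_deriv1 i a b).mul (s1 (1, 0) a b)).add ((V2_deriv1 i a b).mul (s1 (0, 1) a b)))
  have q2 : ∀ i, fderiv ℝ (Xd i U) (stereoN (a, b)) (dN2 (a, b)) =
      (V12 i (a, b) * fderiv ℝ w (a, b) (1, 0) + V1 i (a, b) * fderiv ℝ (fderiv ℝ w) (a, b) (0, 1) (1, 0))
      + (V22 i (a, b) * fderiv ℝ w (a, b) (0, 1) + V2 i (a, b) * fderiv ℝ (fderiv ℝ w) (a, b) (0, 1) (0, 1)) := by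
    intro i
    have h := comp_deriv2 (Xd_contDiffOn i hU) a b
    simp only [hX] at h
    exact h.unique (((V1_deriv2 i a b).mul (s2 (1, 0) a b)).add ((V2_deriv2 i a b).mul (s2 (0, 1) a b)))
  have hlap : lap w (a, b) = fderiv ℝ (fderiv ℝ w) (a, b) (1, 0) (1, 0)
      + fderiv ℝ (fderiv ℝ w) (a, b) (0, 1) (0, 1) := by
    unfold lap
    rw [iteratedFDeriv_two_apply, iteratedFDeriv_two_apply]
    rfl
  rw [hlap]
  unfold LapX
  simp only [Xd_stereoN _ (Xd _ U), q1, q2]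
  generalize fderiv ℝ (fderiv ℝ w) (a, b) (1, 0) (1, 0) = w11
  generalize fderiv ℝ (fderiv ℝ w) (a, b) (1, 0) (0, 1) = w12
  generalize fderiv ℝ (fderiv ℝ w) (a, b) (0, 1) (1, 0) = w21
  generalize fderiv ℝ (fderiv ℝ w) (a, b) (0, 1) (0, 1) = w22
  generalize fderiv ℝ w (a, b) (1, 0) = w1
  generalize fderiv ℝ w (a, b) (0, 1) = w2
  simp [V1, V2, V11, V12, V21, V22]
  ring

/-- Euclidean length. -/
def rr (x : Fin 3 → ℝ) : ℝ := √(x 0 ^ 2 + x 1 ^ 2 + x 2 ^ 2)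

/-- Zero-homogeneous extension. -/
def UU (u : (Fin 3 → ℝ) → ℝ) (x : Fin 3 → ℝ) : ℝ := u (fun k => x k / rr x)

lemma UU_sphere (u : (Fin 3 → ℝ) → ℝ) {x : Fin 3 → ℝ} (hx : x ∈ sphere3) : UU u x = u x := by
  have h : x 0 ^ 2 + x 1 ^ 2 + x 2 ^ 2 = 1 := hx
  simp [UU, rr, h]

lemma rr_sq (x : Fin 3 → ℝ) : rr x ^ 2 = x 0 ^ 2 + x 1 ^ 2 + x 2 ^ 2 :=
  Real.sq_sqrt (by positivity)

lemma rr_cont : Continuous rr := by unfold rr; fun_prop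

lemma rr_pos {x : Fin 3 → ℝ} (hx : x ∈ OO) : 0 < rr x := by
  apply Real.sqrt_pos.2
  by_contra h
  apply hx
  push Not at h
  have h0 := sq_nonneg (x 0)
  have h1 := sq_nonneg (x 1)
  have h2 := sq_nonneg (x 2)
  funext k
  fin_cases k
  · exact pow_eq_zero_iff (two_ne_zero) |>.1 (by linarith : x 0 ^ 2 = 0)
  · exact pow_eq_zero_iff (two_ne_zero) |>.1 (by linarith : x 1 ^ 2 = 0)
  · exact pow_eq_zero_iff (two_ne_zero) |>.1 (by linarith : x 2 ^ 2 = 0)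

lemma rr_contDiffAt {x : Fin 3 → ℝ} (hx : x ∈ OO) : ContDiffAt ℝ 2 rr x := by
  have h := rr_pos hx
  have hk : ∀ k, ContDiffAt ℝ 2 (fun z : Fin 3 → ℝ => z k) x := fun k =>
    (contDiff_apply ℝ ℝ k).contDiffAt
  apply ContDiffAt.sqrt
  · exact (((hk 0).pow 2).add ((hk 1).pow 2)).add ((hk 2).pow 2)
  · intro h0
    have := rr_sq x
    rw [h0] at this
    nlinarith

lemma UU_contDiffOn {u : (Fin 3 → ℝ) → ℝ} (hN : ContDiff ℝ 2 (fun y => u (stereoN y)))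
    (hS : ContDiff ℝ 2 (fun y => u (stereoS y))) : ContDiffOn ℝ 2 (UU u) OO := by
  intro x hx
  apply ContDiffAt.contDiffWithinAt
  have hr := rr_pos hx
  have hk : ∀ k, ContDiffAt ℝ 2 (fun z : Fin 3 → ℝ => z k) x := fun k =>
    (contDiff_apply ℝ ℝ k).contDiffAt
  have hrd := rr_contDiffAt hx
  rcases lt_or_ge (x 2) (rr x) with h | h
  · have hev : UU u =ᶠ[𝓝 x]
        fun z => (fun y => u (stereoN y)) (z 0 / (rr z - z 2), z 1 / (rr z - z 2)) := by
      have ho : IsOpen {z : Fin 3 → ℝ | z 2 < rr z ∧ 0 < rr z} :=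
        (isOpen_lt (by fun_prop) rr_cont).inter (isOpen_lt (by fun_prop) rr_cont)
      filter_upwards [ho.mem_nhds ⟨h, hr⟩] with z hz
      have h1 : 0 < rr z - z 2 := sub_pos.2 hz.1
      have h2 := hz.2
      have h3 := rr_sq z
      unfold UU
      congr 1
      set d := rr z - z 2 with hd
      have hq : 1 + (z 0 / d) ^ 2 + (z 1 / d) ^ 2 = 2 * rr z / d := by
        field_simp
        rw [hd]
        linear_combination -h3
      funext k
      fin_cases k <;> simp [stereoN, hq]
      · field_simp
      · field_simp
      · have hq' : (z 0 / d) ^ 2 + (z 1 / d) ^ 2 - 1 = 2 * z 2 / d := by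
          have : 2 * rr z / d = 2 + 2 * z 2 / d := by field_simp; rw [hd]; ring
          linarith
        rw [hq']
        field_simp
    refine ContDiffAt.congr_of_eventuallyEq ?_ hev
    have hne : rr x - x 2 ≠ 0 := (sub_pos.2 h).ne'
    exact hN.contDiffAt.comp x
      (((hk 0).div (hrd.sub (hk 2)) hne).prodMk ((hk 1).div (hrd.sub (hk 2)) hne))
  · have hev : UU u =ᶠ[𝓝 x]
        fun z => (fun y => u (stereoS y)) (z 0 / (rr z + z 2), z 1 / (rr z + z 2)) := by
      have ho : IsOpen {z : Fin 3 → ℝ | 0 < rr z + z 2 ∧ 0 < rr z} :=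
        (isOpen_lt (by fun_prop) (rr_cont.add (by fun_prop))).inter (isOpen_lt (by fun_prop) rr_cont)
      filter_upwards [ho.mem_nhds ⟨by linarith, hr⟩] with z hz
      have h1 : 0 < rr z + z 2 := hz.1
      have h2 := hz.2
      have h3 := rr_sq z
      unfold UU
      congr 1
      set d := rr z + z 2 with hd
      have hq : 1 + (z 0 / d) ^ 2 + (z 1 / d) ^ 2 = 2 * rr z / d := by
        field_simp
        rw [hd]
        linear_combination -h3
      funext k
      fin_cases k <;> simp [stereoS, hq]
      · field_simp
      · field_simp
      · have hq' : 1 - (z 0 / d) ^ 2 - (z 1 / d) ^ 2 = 2 * z 2 / d := by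
          have : 2 * rr z / d = 2 - 2 * z 2 / d := by field_simp; rw [hd]; ring
          linarith
        rw [hq']
        field_simp
    refine ContDiffAt.congr_of_eventuallyEq ?_ hev
    have hne : rr x + x 2 ≠ 0 := by linarith
    exact hS.contDiffAt.comp x
      (((hk 0).div (hrd.add (hk 2)) hne).prodMk ((hk 1).div (hrd.add (hk 2)) hne))

lemma rot_sphere (i : Fin 3) (t : ℝ) {x : Fin 3 → ℝ} (hx : x ∈ sphere3) : rot i t x ∈ sphere3 := by
  have h : x 0 ^ 2 + x 1 ^ 2 + x 2 ^ 2 = 1 := hx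
  have hs := Real.sin_sq_add_cos_sq t
  change (rot i t x) 0 ^ 2 + (rot i t x) 1 ^ 2 + (rot i t x) 2 ^ 2 = 1
  rw [← h]
  fin_cases i <;> simp [rot]
  · linear_combination (x 1 ^ 2 + x 2 ^ 2) * hs
  · linear_combination (x 0 ^ 2 + x 2 ^ 2) * hs
  · linear_combination (x 0 ^ 2 + x 1 ^ 2) * hs

/-- For a solution of the mean field equation with `λ > 0`,
`∫_{S²} Xᵢu Xⱼu Xₖu e^u dσ = 0` for all `i, j, k`. -/
theorem killing_cubic_integral_zero (lam : ℝ) (hlam : 0 < lam)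
    (u : (Fin 3 → ℝ) → ℝ) (hu : IsMFSolution lam u) :
    ∀ i j k : Fin 3,
      sphereIntegral (fun x =>
        killingDeriv i u x * killingDeriv j u x * killingDeriv k u x * Real.exp (u x)) = 0 := by
  obtain ⟨-, hN, hS, hE, -⟩ := hu
  have hU := UU_contDiffOn hN hS
  have hU1 : ContDiffOn ℝ 1 (UU u) OO := hU.of_le (by norm_num)
  have eN : (fun y => UU u (stereoN y)) = fun y => u (stereoN y) :=
    funext fun y => UU_sphere u (stereoN_mem y)
  have hL : ∀ y, LapX (UU u) (stereoN y) = lam * (1 - Real.exp (UU u (stereoN y))) := by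
    intro y
    have h : (1 + y.1 ^ 2 + y.2 ^ 2) ≠ 0 := (qq_pos y).ne'
    rw [lap_chart hU (by rw [eN]; exact hN) y, eN, hE y, UU_sphere u (stereoN_mem y)]
    field_simp
  have hK : ∀ i, ∀ x ∈ sphere3, killingDeriv i u x = Xd i (UU u) x := by
    intro i x hx
    unfold killingDeriv
    have e : (fun t => u (rot i t x)) = fun t => UU u (rot i t x) :=
      funext fun t => (UU_sphere u (rot_sphere i t hx)).symm
    rw [e, (hasDerivAt_rot i 0 hU1 (sphere3_sub hx)).deriv, rot_zero_apply]
  intro i j k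
  rw [← cubic hlam.ne' hU hL i j k]
  apply sphere_congr
  intro x hx
  simp only [hK _ x hx, UU_sphere u hx]
end
end
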